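/- arXiv:1007.1165 — 2 statements merged into one kernel-verified Lean document; each statement's English description precedes it below -/
import Mathlib

section
/- For all 1 ≤ r,s ≤ n and all m, n ∈ ℤ^{N+1}, [ρ(H_r)_m, ρ(F_s)_n] = −Â_{rs} ρ(F_s)_{m+n} as operators on V. -/
noncomputable section

namespace Stmt12

/-- Multi-indices `m ∈ ℤ^{N+1}`. -/
abbrev MM (N : ℕ) := Fin (N + 1) → ℤ

/-- Index type for the polynomial variables `x_{ij}(m)`, `1 ≤ i < j ≤ n+1`. -/
def XIdx (n N : ℕ) := {ij : ℕ × ℕ // 1 ≤ ij.1 ∧ ij.1 < ij.2 ∧ ij.2 ≤ n + 1} × MM N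

/-- Index type for the polynomial variables `y_i(k)`, `1 ≤ i ≤ n`, `k > 0`. -/
def YIdx (n N : ℕ) (pos : MM N → Prop) :=
  {i : ℕ // 1 ≤ i ∧ i ≤ n} × {k : MM N // pos k}

/-- The Fock space `V = ℂ[x] ⊗ ℂ[y]`, realized as the polynomial ring in the
two (disjoint) families of variables. -/
abbrev Fock (n N : ℕ) (pos : MM N → Prop) :=
  MvPolynomial (XIdx n N ⊕ YIdx n N pos) ℂ

/-- `a_{ij,m}`: multiplication by `-x_{ij}(m)` (and `0` for out-of-range indices). -/
def aop (n N : ℕ) (pos : MM N → Prop) (i j : ℕ) (m : MM N) :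
    Fock n N pos → Fock n N pos := fun w =>
  if h : 1 ≤ i ∧ i < j ∧ j ≤ n + 1 then
    -(MvPolynomial.X (Sum.inl ((⟨(i, j), h⟩, m) : XIdx n N)) : Fock n N pos) * w
  else 0

/-- `a*_{ij,m}`: the partial derivative `∂/∂x_{ij}(-m)` (and `0` for
out-of-range indices). -/
def astar (n N : ℕ) (pos : MM N → Prop) (i j : ℕ) (m : MM N) :
    Fock n N pos → Fock n N pos := fun w =>
  if h : 1 ≤ i ∧ i < j ∧ j ≤ n + 1 then
    MvPolynomial.pderiv (Sum.inl ((⟨(i, j), h⟩, -m) : XIdx n N)) w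
  else 0

/-- `(κ·D a*_{ij})_v := Σ_{q ∈ ℤ^{N+1}} Σ_{p=0}^N κ_{q-v,p}(-q_p) a*_{ij,q}`,
a pointwise locally finite sum of operators. -/
def kD (n N : ℕ) (pos : MM N → Prop) (kappa : MM N → Fin (N + 1) → ℂ)
    (i j : ℕ) (v : MM N) : Fock n N pos → Fock n N pos := fun w =>
  ∑ᶠ q : MM N,
    (∑ p : Fin (N + 1), kappa (q - v) p * (-(q p : ℂ))) • astar n N pos i j q w

open Classical in
/-- `θ(m) = 1` if `m > 0` and `0` otherwise. -/
def theta {N : ℕ} (pos : MM N → Prop) (m : MM N) : ℂ := if pos m then 1 else 0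

open Classical in
/-- `∂/∂y_i(s)`, with the convention that it is `0` unless `1 ≤ i ≤ n` and `s > 0`. -/
def ydot (n N : ℕ) (pos : MM N → Prop) (i : ℕ) (s : MM N) :
    Fock n N pos → Fock n N pos := fun w =>
  if h : (1 ≤ i ∧ i ≤ n) ∧ pos s then
    MvPolynomial.pderiv (Sum.inr ((⟨i, h.1⟩, ⟨s, h.2⟩) : YIdx n N pos)) w
  else 0

/-- `Σ_{p=0}^N m_p κ_{-m+s,p}`. -/
def cnum {N : ℕ} (kappa : MM N → Fin (N + 1) → ℂ) (m s : MM N) : ℂ :=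
  ∑ p : Fin (N + 1), (m p : ℂ) * kappa (-m + s) p

open Classical in
/-- The operator `Φ(b_i(m))` (for `1 ≤ i ≤ n`), acting on `V`. -/
def Phi (n N : ℕ) (pos : MM N → Prop) (kappa : MM N → Fin (N + 1) → ℂ)
    (lam : ℕ → ℂ) (i : ℕ) (m : MM N) : Fock n N pos → Fock n N pos := fun w =>
  theta pos (-m) • (∑ᶠ s : MM N, cnum kappa m s •
      (ydot n N pos (i - 1) s w - ydot n N pos i s w))
  + theta pos m • (∑ᶠ s : MM N, cnum kappa m s •
      (ydot n N pos (i - 1) s w - (2 : ℂ) • ydot n N pos i s w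
        + ydot n N pos (i + 1) s w))
  + (if h : (1 ≤ i ∧ i ≤ n) ∧ pos (-m) then
      (MvPolynomial.X (Sum.inr ((⟨i, h.1⟩, ⟨-m, h.2⟩) : YIdx n N pos)) :
          Fock n N pos) * w
    else 0)
  - (if m = 0 then lam i else 0) • w

/-- `Φ(b_0(m)) := -Σ_{i=1}^n Φ(b_i(m))`, and `Φ(b_i(m))` for `1 ≤ i ≤ n`. -/
def PhiHat (n N : ℕ) (pos : MM N → Prop) (kappa : MM N → Fin (N + 1) → ℂ)
    (lam : ℕ → ℂ) (i : ℕ) (m : MM N) : Fock n N pos → Fock n N pos :=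
  if i = 0 then -(∑ r ∈ Finset.Icc 1 n, Phi n N pos kappa lam r m)
  else Phi n N pos kappa lam i m

/-- The `m`-th mode of the product of two families of operators:
`(XY)_m := Σ_{k+l=m} X_k Y_l` (pointwise locally finite sum). -/
def fmul (n N : ℕ) (pos : MM N → Prop)
    (X Y : MM N → Fock n N pos → Fock n N pos) :
    MM N → Fock n N pos → Fock n N pos :=
  fun m w => ∑ᶠ k : MM N, X k (Y (m - k) w)

/-- Modewise product of a finite list of families of operators; the empty
product is the identity family (the delta family supported at `0`). -/
def fprod (n N : ℕ) (pos : MM N → Prop) :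
    List (MM N → Fock n N pos → Fock n N pos) →
      MM N → Fock n N pos → Fock n N pos
  | [] => fun m w => if m = 0 then w else 0
  | X :: L => fmul n N pos X (fprod n N pos L)

/-- The affine Cartan matrix of type `A_n^{(1)}` (indices `0 ≤ i, j ≤ n`), as an
integer matrix. -/
def AcarZ (n i j : ℕ) : ℤ :=
  if i = j then 2
  else if (i + 1) % (n + 1) = j % (n + 1) ∨ (j + 1) % (n + 1) = i % (n + 1) then -1
  else 0

/-- The affine Cartan matrix of type `A_n^{(1)}`, with complex entries. -/
def Acar (n i j : ℕ) : ℂ := (AcarZ n i j : ℂ)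

/-- `ρ(F_r)_m` for `1 ≤ r ≤ n`. -/
def rhoF (n N : ℕ) (pos : MM N → Prop) (r : ℕ) (m : MM N) :
    Fock n N pos → Fock n N pos :=
  aop n N pos r (r + 1) m
    - ∑ j ∈ Finset.Ico 1 r, fmul n N pos (aop n N pos j (r + 1)) (astar n N pos j r) m

/-- `ρ(H_r)_m` for `1 ≤ r ≤ n`. -/
def rhoHn (n N : ℕ) (pos : MM N → Prop) (kappa : MM N → Fin (N + 1) → ℂ)
    (lam : ℕ → ℂ) (r : ℕ) (m : MM N) : Fock n N pos → Fock n N pos :=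
  (2 : ℂ) • fmul n N pos (aop n N pos r (r + 1)) (astar n N pos r (r + 1)) m
  + ∑ i ∈ Finset.Ico 1 r,
      (fmul n N pos (aop n N pos i (r + 1)) (astar n N pos i (r + 1)) m
        - fmul n N pos (aop n N pos i r) (astar n N pos i r) m)
  + ∑ j ∈ Finset.Icc (r + 2) (n + 1),
      (fmul n N pos (aop n N pos r j) (astar n N pos r j) m
        - fmul n N pos (aop n N pos (r + 1) j) (astar n N pos (r + 1) j) m)
  + Phi n N pos kappa lam r m

/-- `ρ(H_r)_m` for `0 ≤ r ≤ n`, with `ρ(H_0)_m := -Σ_{r=1}^n ρ(H_r)_m`. -/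
def rhoH (n N : ℕ) (pos : MM N → Prop) (kappa : MM N → Fin (N + 1) → ℂ)
    (lam : ℕ → ℂ) (r : ℕ) (m : MM N) : Fock n N pos → Fock n N pos :=
  if r = 0 then -(∑ s ∈ Finset.Icc 1 n, rhoHn n N pos kappa lam s m)
  else rhoHn n N pos kappa lam r m

/-- `ρ(E_r)_m` for `1 ≤ r ≤ n`. -/
def rhoEn (n N : ℕ) (pos : MM N → Prop) (kappa : MM N → Fin (N + 1) → ℂ)
    (lam : ℕ → ℂ) (r : ℕ) (m : MM N) : Fock n N pos → Fock n N pos :=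
  fmul n N pos (aop n N pos r (r + 1))
      (fmul n N pos (astar n N pos r (r + 1)) (astar n N pos r (r + 1))) m
  - ∑ j ∈ Finset.Icc (r + 2) (n + 1),
      fmul n N pos (aop n N pos (r + 1) j) (astar n N pos r j) m
  + ∑ j ∈ Finset.Ico 1 r,
      fmul n N pos (aop n N pos j r) (astar n N pos j (r + 1)) m
  + ∑ j ∈ Finset.Icc (r + 2) (n + 1),
      (fmul n N pos (fmul n N pos (aop n N pos r j) (astar n N pos r j))
          (astar n N pos r (r + 1)) m
        - fmul n N pos (fmul n N pos (aop n N pos (r + 1) j) (astar n N pos (r + 1) j))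
            (astar n N pos r (r + 1)) m)
  + fmul n N pos (astar n N pos r (r + 1)) (Phi n N pos kappa lam r) m
  + kD n N pos kappa r (r + 1) m

/-- `ρ(E_r)_m` for `0 ≤ r ≤ n`, with `ρ(E_0)_m := -a_{1,n+1;m}`. -/
def rhoE (n N : ℕ) (pos : MM N → Prop) (kappa : MM N → Fin (N + 1) → ℂ)
    (lam : ℕ → ℂ) (r : ℕ) (m : MM N) : Fock n N pos → Fock n N pos :=
  if r = 0 then -(aop n N pos 1 (n + 1) m) else rhoEn n N pos kappa lam r m

/-- The strictly increasing sequence `1 = q_1 < q_2 < ⋯ < q_i` encoded by a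
subset `s ⊆ {2,…,n+1}`, as the sorted list `1 :: sort s`. -/
def ql (s : Finset ℕ) : List ℕ := 1 :: s.sort (· ≤ ·)

/-- The last entry `q_i` of the sequence encoded by `s`. -/
def qend (s : Finset ℕ) : ℕ := ((ql s).getLast?).getD 0

/-- The second-to-last entry `q_{i-1}` of the sequence encoded by `s`
(`0` if the sequence has length `1`, so that the condition `q_{i-1} ≤ r` is
vacuous in that case). -/
def qpen (s : Finset ℕ) : ℕ := (((ql s).dropLast).getLast?).getD 0

/-- The list of adjacent pairs `(q_l, q_{l+1})` of a list. -/
def qpairs (l : List ℕ) : List (ℕ × ℕ) := l.zip l.tail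

/-- `ρ(F_0)_m`. -/
def rhoF0 (n N : ℕ) (pos : MM N → Prop) (kappa : MM N → Fin (N + 1) → ℂ)
    (lam : ℕ → ℂ) (m : MM N) : Fock n N pos → Fock n N pos :=
  -(∑ r ∈ Finset.Icc 1 (n + 1), ∑ j ∈ Finset.Icc 1 (n + 1),
      ∑ s ∈ (Finset.Icc 2 (n + 1)).powerset,
        if r < j ∧ qend s = j ∧ qpen s ≤ r then
          fprod n N pos
            (aop n N pos r j ::
              ((qpairs (ql s)).map fun p => astar n N pos p.1 p.2)
                ++ [astar n N pos r (n + 1)]) m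
        else 0)
  - (∑ r ∈ Finset.Icc 1 n, ∑ s ∈ (Finset.Icc 2 (n + 1)).powerset,
      if qend s ≤ r then
        fprod n N pos
          (((qpairs (ql s ++ [n + 1])).map fun p => astar n N pos p.1 p.2)
            ++ [Phi n N pos kappa lam r]) m
      else 0)
  - (∑ r ∈ Finset.Icc 1 n, ∑ s ∈ (Finset.Icc 2 (n + 1)).powerset,
      if qend s = r then
        fprod n N pos
          (((qpairs (ql s)).map fun p => astar n N pos p.1 p.2)
            ++ [kD n N pos kappa r (n + 1)]) m
      else 0)

/-- `ρ(F_r)_m` for `0 ≤ r ≤ n`. -/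
def rhoFa (n N : ℕ) (pos : MM N → Prop) (kappa : MM N → Fin (N + 1) → ℂ)
    (lam : ℕ → ℂ) (r : ℕ) (m : MM N) : Fock n N pos → Fock n N pos :=
  if r = 0 then rhoF0 n N pos kappa lam m else rhoF n N pos r m

/-- The commutator of two operators. -/
def comm {V : Type*} [AddCommGroup V] (f g : V → V) : V → V :=
  fun w => f (g w) - g (f w)

section Derivations

open MvPolynomial

/-- A pointwise locally finite sum of derivations is a derivation. -/
theorem exists_derivation_finsum {R A K : Type*} [CommRing R] [CommRing A] [Algebra R A]
    (D : K → Derivation R A A) (hD : ∀ w, (Function.support fun k => D k w).Finite) :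
    ∃ E : Derivation R A A, ∀ w, E w = ∑ᶠ k, D k w := by
  refine ⟨Derivation.mk' ⟨⟨fun w => ∑ᶠ k, D k w, fun a b => ?_⟩, fun c a => ?_⟩
    fun a b => ?_, fun w => rfl⟩
  · simp only [map_add]
    exact finsum_add_distrib (hD a) (hD b)
  · simp only [Derivation.map_smul, RingHom.id_apply]
    exact (smul_finsum' c (hD a)).symm
  · simp only [Derivation.leibniz, LinearMap.coe_mk, AddHom.coe_mk]
    rw [finsum_add_distrib ((hD b).subset _) ((hD a).subset _), smul_finsum' _ (hD b),
      smul_finsum' _ (hD a)]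
    all_goals
      intro k hk h0
      exact hk (by simp_all)

/-- Along an injective family of variables only finitely many partial derivatives of a
polynomial are nonzero. -/
theorem finite_support_pderiv {σ K : Type*} {g : K → σ} (hg : Function.Injective g)
    (w : MvPolynomial σ ℂ) : (Function.support fun k => pderiv (g k) w).Finite := by
  refine (w.vars.finite_toSet.preimage hg.injOn).subset fun k hk => ?_
  by_contra h
  exact hk (pderiv_eq_zero_of_notMem_vars h)

theorem derivation_sum_apply {R A ι : Type*} [CommRing R] [CommRing A] [Algebra R A]
    (s : Finset ι) (D : ι → Derivation R A A) (w : A) : (∑ i ∈ s, D i) w = ∑ i ∈ s, D i w := by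
  classical
  induction s using Finset.induction_on with
  | empty => simp
  | insert a s ha ih => simp [Finset.sum_insert ha, ih]

variable {n N : ℕ} {pos : MM N → Prop}

/-- The index of the variable `x_{ij}(m)`. -/
def xIdx {i j : ℕ} (h : 1 ≤ i ∧ i < j ∧ j ≤ n + 1) (m : MM N) : XIdx n N := (⟨(i, j), h⟩, m)

/-- The index of the variable `y_i(k)`. -/
def yIdx {i : ℕ} (h : 1 ≤ i ∧ i ≤ n) {k : MM N} (hk : pos k) : YIdx n N pos := (⟨i, h⟩, ⟨k, hk⟩)

theorem astar_apply {i j : ℕ} (h : 1 ≤ i ∧ i < j ∧ j ≤ n + 1) (m : MM N) (w : Fock n N pos) :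
    astar n N pos i j m w = pderiv (Sum.inl (xIdx h (-m))) w := dif_pos h

/-- The variable `x_{ij}(m)`, or `0` for out-of-range indices. -/
def xvar (n N : ℕ) (pos : MM N → Prop) (i j : ℕ) (m : MM N) : Fock n N pos :=
  if h : 1 ≤ i ∧ i < j ∧ j ≤ n + 1 then
    X (Sum.inl (xIdx h m))
  else 0

theorem aop_apply (i j : ℕ) (m : MM N) (w : Fock n N pos) :
    aop n N pos i j m w = -xvar n N pos i j m * w := by
  by_cases h : 1 ≤ i ∧ i < j ∧ j ≤ n + 1
  · rw [xvar, dif_pos h]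
    exact dif_pos h
  · rw [xvar, dif_neg h, neg_zero, zero_mul]
    exact dif_neg h

theorem xvar_eq_X (x : XIdx n N) :
    xvar n N pos x.1.1.1 x.1.1.2 x.2 = X (Sum.inl x) := dif_pos x.1.2

/-- The derivation `x_{kl}(p) ↦ -x_{ij}(p + m)` killing all other variables. -/
def shiftD (n N : ℕ) (pos : MM N → Prop) (i j k l : ℕ) (m : MM N) :
    Derivation ℂ (Fock n N pos) (Fock n N pos) :=
  mkDerivation ℂ (Sum.elim
    (fun x : XIdx n N => if x.1.1.1 = k ∧ x.1.1.2 = l then -xvar n N pos i j (x.2 + m) else 0)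
    (fun _ => 0))

theorem fmul_aop_astar (i j k l : ℕ) (m : MM N) (w : Fock n N pos) :
    fmul n N pos (aop n N pos i j) (astar n N pos k l) m w = shiftD n N pos i j k l m w := by
  by_cases h : 1 ≤ k ∧ k < l ∧ l ≤ n + 1
  · have hinj : Function.Injective fun q : MM N =>
        (Sum.inl (xIdx h (-(m - q))) : XIdx n N ⊕ YIdx n N pos) := by
      intro a b hab
      have : -(m - a) = -(m - b) := congrArg Prod.snd (Sum.inl_injective hab)
      simpa using this
    obtain ⟨E, hE⟩ := exists_derivation_finsum
      (fun q : MM N => (-xvar n N pos i j q) •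
        pderiv (R := ℂ) (Sum.inl (xIdx h (-(m - q))) : XIdx n N ⊕ YIdx n N pos))
      (fun w => (finite_support_pderiv hinj w).subset fun q hq h0 => hq (by simp_all))
    have hfm : fmul n N pos (aop n N pos i j) (astar n N pos k l) m w = E w := by
      rw [hE]
      refine finsum_congr fun q => ?_
      rw [aop_apply]
      rw [astar_apply h, Derivation.smul_apply, smul_eq_mul]
    have hEq : E = shiftD n N pos i j k l m := by
      refine derivation_ext fun z => ?_
      rw [hE, shiftD, mkDerivation_X]
      rcases z with x | y
      · rw [finsum_eq_single _ (x.2 + m)]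
        · simp only [Sum.elim_inl, Derivation.smul_apply]
          split_ifs with hx
          · have : x = xIdx h (-(m - (x.2 + m))) :=
              Prod.ext (Subtype.ext (Prod.ext hx.1 hx.2)) (by simp [xIdx])
            rw [← this, pderiv_X_self]
            simp
          · rw [pderiv_X_of_ne, smul_zero]
            intro hne
            rw [Sum.inl_injective hne] at hx
            exact hx ⟨rfl, rfl⟩
        · intro q hq
          rw [Derivation.smul_apply, pderiv_X_of_ne, smul_zero]
          intro hne
          have : x.2 = -(m - q) := congrArg Prod.snd (Sum.inl_injective hne)
          exact hq (by simp [this])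
      · refine (finsum_congr fun q => ?_).trans finsum_zero
        rw [Derivation.smul_apply, pderiv_X_of_ne Sum.inr_ne_inl, smul_zero]
    rw [hfm, hEq]
  · have h1 : shiftD n N pos i j k l m = 0 := by
      refine derivation_ext fun z => ?_
      rw [shiftD, mkDerivation_X]
      rcases z with x | y
      · have : ¬ (x.1.1.1 = k ∧ x.1.1.2 = l) := by
          rintro ⟨rfl, rfl⟩
          exact h x.1.2
        simp [this]
      · simp
    simp [h1, fmul, aop_apply, astar, h]

/-- The value of the simple root `α_r` on `ε_i - ε_j`. -/
def rootWeight (r i j : ℕ) : ℂ :=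
  (if i = r then 1 else 0) - (if i = r + 1 then 1 else 0)
    - (if j = r then 1 else 0) + (if j = r + 1 then 1 else 0)

/-- The derivation `x_{ij}(p) ↦ -α_r(ε_i - ε_j) x_{ij}(p + m)` killing the variables `y`. -/
def weightD (n N : ℕ) (pos : MM N → Prop) (r : ℕ) (m : MM N) :
    Derivation ℂ (Fock n N pos) (Fock n N pos) :=
  mkDerivation ℂ (Sum.elim
    (fun x : XIdx n N => -(rootWeight r x.1.1.1 x.1.1.2 •
      xvar n N pos x.1.1.1 x.1.1.2 (x.2 + m)))
    (fun _ => 0))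

/-- The derivation `x_{is}(p) ↦ -x_{i,s+1}(p + m)` killing all other variables. -/
def lowerD (n N : ℕ) (pos : MM N → Prop) (s : ℕ) (m : MM N) :
    Derivation ℂ (Fock n N pos) (Fock n N pos) :=
  mkDerivation ℂ (Sum.elim
    (fun x : XIdx n N => if x.1.1.2 = s then -xvar n N pos x.1.1.1 (s + 1) (x.2 + m) else 0)
    (fun _ => 0))

theorem shiftD_self_X_inl (i j : ℕ) (m : MM N) (x : XIdx n N) :
    shiftD n N pos i j i j m (X (Sum.inl x)) =
      (if x.1.1.1 = i then if x.1.1.2 = j then (1 : ℂ) else 0 else 0) •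
        (-xvar n N pos x.1.1.1 x.1.1.2 (x.2 + m)) := by
  rw [shiftD, mkDerivation_X, Sum.elim_inl, ite_and]
  split_ifs with h1 h2
  · rw [one_smul, h1, h2]
  · simp
  · simp

theorem sum_shiftD_eq_lowerD (s : ℕ) (m : MM N) :
    ∑ j ∈ Finset.Ico 1 s, shiftD n N pos j (s + 1) j s m = lowerD n N pos s m := by
  refine derivation_ext fun z => ?_
  rw [derivation_sum_apply]
  simp only [shiftD, lowerD, mkDerivation_X]
  rcases z with x | y
  · have hx := x.1.2
    simp only [Sum.elim_inl, ite_and, Finset.sum_ite_eq, Finset.mem_Ico]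
    split_ifs <;> first | rfl | omega
  · simp

theorem sum_shiftD_eq_weightD (r : ℕ) (hr : 1 ≤ r) (m : MM N) :
    (2 : ℂ) • shiftD n N pos r (r + 1) r (r + 1) m
      + ∑ i ∈ Finset.Ico 1 r,
          (shiftD n N pos i (r + 1) i (r + 1) m - shiftD n N pos i r i r m)
      + ∑ j ∈ Finset.Icc (r + 2) (n + 1),
          (shiftD n N pos r j r j m - shiftD n N pos (r + 1) j (r + 1) j m)
      = weightD n N pos r m := by
  refine derivation_ext fun z => ?_
  simp only [Derivation.add_apply, Derivation.smul_apply, derivation_sum_apply,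
    Derivation.sub_apply]
  rcases z with x | y
  · have hx := x.1.2
    simp only [shiftD_self_X_inl, weightD, mkDerivation_X, Sum.elim_inl, ← sub_smul,
      ← Finset.sum_smul, smul_smul, ← add_smul]
    rw [← smul_neg]
    congr 1
    simp only [Finset.sum_sub_distrib, Finset.sum_ite_eq, Finset.sum_ite_irrel,
      Finset.sum_const_zero, Finset.mem_Ico, Finset.mem_Icc, rootWeight]
    generalize x.1.1.1 = a at *
    generalize x.1.1.2 = b at *
    split_ifs <;> first | omega | norm_num
  · simp [shiftD, weightD, mkDerivation_X]

theorem rhoF_apply (s : ℕ) (m : MM N) (w : Fock n N pos) :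
    rhoF n N pos s m w = -xvar n N pos s (s + 1) m * w - lowerD n N pos s m w := by
  simp only [rhoF, Pi.sub_apply, Finset.sum_apply, aop_apply, fmul_aop_astar,
    ← derivation_sum_apply, sum_shiftD_eq_lowerD]

theorem rhoHn_apply (kappa : MM N → Fin (N + 1) → ℂ) (lam : ℕ → ℂ) (r : ℕ)
    (hr : 1 ≤ r) (m : MM N) (w : Fock n N pos) :
    rhoHn n N pos kappa lam r m w
      = weightD n N pos r m w + Phi n N pos kappa lam r m w := by
  rw [← sum_shiftD_eq_weightD r hr]
  simp only [rhoHn, Pi.add_apply, Pi.sub_apply, Pi.smul_apply, Finset.sum_apply,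
    fmul_aop_astar, Derivation.add_apply, Derivation.smul_apply, derivation_sum_apply,
    Derivation.sub_apply]

theorem weightD_xvar (r : ℕ) (m : MM N) (i j : ℕ) (p : MM N) :
    weightD n N pos r m (xvar n N pos i j p)
      = -(rootWeight r i j • xvar n N pos i j (p + m)) := by
  by_cases h : 1 ≤ i ∧ i < j ∧ j ≤ n + 1
  · rw [xvar, dif_pos h, weightD, mkDerivation_X]
    rfl
  · simp [xvar, h]

theorem lowerD_xvar (s : ℕ) (m : MM N) (i j : ℕ) (p : MM N) (h : 1 ≤ i ∧ i < j ∧ j ≤ n + 1) :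
    lowerD n N pos s m (xvar n N pos i j p)
      = if j = s then -xvar n N pos i (s + 1) (p + m) else 0 := by
  rw [xvar, dif_pos h, lowerD, mkDerivation_X]
  rfl

theorem commutator_weightD_lowerD (r s : ℕ) (m k : MM N) (w : Fock n N pos) :
    weightD n N pos r m (lowerD n N pos s k w) - lowerD n N pos s k (weightD n N pos r m w)
      = -(rootWeight r s (s + 1) • lowerD n N pos s (m + k) w) := by
  rw [← Derivation.commutator_apply, ← Derivation.smul_apply, ← Derivation.neg_apply]
  congr 1
  refine derivation_ext fun z => ?_
  rw [Derivation.commutator_apply, Derivation.neg_apply, Derivation.smul_apply]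
  rcases z with x | y
  · have hx := x.1.2
    rw [← xvar_eq_X, weightD_xvar, map_neg, Derivation.map_smul, lowerD_xvar _ _ _ _ _ hx,
      lowerD_xvar _ _ _ _ _ hx, lowerD_xvar _ _ _ _ _ hx]
    split_ifs with h
    · rw [map_neg, weightD_xvar, add_assoc, add_assoc, add_comm k m, h]
      rw [smul_neg, neg_neg, neg_neg, smul_neg, neg_neg, ← sub_smul]
      congr 1
      simp only [rootWeight]
      ring
    · simp
  · simp [weightD, lowerD, mkDerivation_X]

/-- The derivations killing the variables `x` and mapping the variables `y` to constants. -/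
def constantYDerivations (n N : ℕ) (pos : MM N → Prop) :
    Submodule ℂ (Derivation ℂ (Fock n N pos) (Fock n N pos)) where
  carrier := {D | (∀ x, D (X (Sum.inl x)) = 0) ∧ ∀ y, ∃ c, D (X (Sum.inr y)) = C c}
  zero_mem' := ⟨fun _ => rfl, fun _ => ⟨0, by simp⟩⟩
  add_mem' := by
    rintro D E ⟨hD, hD'⟩ ⟨hE, hE'⟩
    refine ⟨fun x => by simp [hD, hE], fun y => ?_⟩
    obtain ⟨a, ha⟩ := hD' y
    obtain ⟨b, hb⟩ := hE' y
    exact ⟨a + b, by simp [ha, hb]⟩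
  smul_mem' := by
    rintro a D ⟨hD, hD'⟩
    refine ⟨fun x => by simp [hD], fun y => ?_⟩
    obtain ⟨b, hb⟩ := hD' y
    exact ⟨a * b, by simp [hb, smul_eq_C_mul]⟩

theorem exists_constantY_finsum {K : Type*}
    (D : K → Derivation ℂ (Fock n N pos) (Fock n N pos))
    (hD : ∀ w, (Function.support fun k => D k w).Finite)
    (hmem : ∀ k, D k ∈ constantYDerivations n N pos) :
    ∃ E ∈ constantYDerivations n N pos, ∀ w, E w = ∑ᶠ k, D k w := by
  obtain ⟨E, hE⟩ := exists_derivation_finsum D hD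
  refine ⟨E, ⟨fun x => ?_, fun y => ?_⟩, hE⟩
  · rw [hE]
    exact (finsum_congr fun k => (hmem k).1 x).trans finsum_zero
  · rw [hE]
    refine finsum_induction (fun w => ∃ c, w = C c) ⟨0, by simp⟩ ?_ fun k => (hmem k).2 y
    rintro _ _ ⟨a, rfl⟩ ⟨b, rfl⟩
    exact ⟨a + b, by simp⟩

open Classical in
/-- The operator `∂/∂y_i(s)` as a derivation. -/
def ydotD (n N : ℕ) (pos : MM N → Prop) (i : ℕ) (s : MM N) :
    Derivation ℂ (Fock n N pos) (Fock n N pos) :=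
  if h : (1 ≤ i ∧ i ≤ n) ∧ pos s then
    pderiv (Sum.inr (yIdx h.1 h.2))
  else 0

theorem ydotD_apply (i : ℕ) (s : MM N) (w : Fock n N pos) :
    ydotD n N pos i s w = ydot n N pos i s w := by
  symm
  by_cases h : (1 ≤ i ∧ i ≤ n) ∧ pos s
  · rw [ydotD, dif_pos h]
    exact dif_pos h
  · rw [ydotD, dif_neg h]
    exact dif_neg h

theorem ydotD_mem (i : ℕ) (s : MM N) : ydotD n N pos i s ∈ constantYDerivations n N pos := by
  classical
  unfold ydotD
  split_ifs with h
  · refine ⟨fun x => pderiv_X_of_ne Sum.inl_ne_inr, fun y => ?_⟩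
    by_cases hy : y = yIdx h.1 h.2
    · exact ⟨1, by rw [hy, pderiv_X_self, C_1]⟩
    · exact ⟨0, by rw [pderiv_X_of_ne (fun e => hy (Sum.inr_injective e)), C_0]⟩
  · exact Submodule.zero_mem _

theorem finite_support_ydotD (i : ℕ) (w : Fock n N pos) :
    (Function.support fun s => ydotD n N pos i s w).Finite := by
  by_cases hi : 1 ≤ i ∧ i ≤ n
  · have hinj : Function.Injective fun s : {k : MM N // pos k} =>
        (Sum.inr (yIdx hi s.2) : XIdx n N ⊕ YIdx n N pos) := fun a b hab =>
      congrArg Prod.snd (Sum.inr_injective hab)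
    refine ((finite_support_pderiv hinj w).image Subtype.val).subset fun s hs => ?_
    by_cases h : pos s
    · refine ⟨⟨s, h⟩, ?_, rfl⟩
      simpa [ydotD, hi, h] using hs
    · exact absurd (by simp [ydotD, h]) hs
  · simp [ydotD, hi]

/-- The operator `Φ(b_i(m))` is a derivation in the variables `y` with constant coefficients
plus multiplication by a polynomial in the variables `y`. -/
theorem exists_Phi_apply (kappa : MM N → Fin (N + 1) → ℂ) (lam : ℕ → ℂ) (i : ℕ) (m : MM N) :
    ∃ Y ∈ constantYDerivations n N pos, ∃ q : Fock n N pos,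
      (∀ w, Phi n N pos kappa lam i m w = Y w + q * w) ∧
      ∀ D : Derivation ℂ (Fock n N pos) (Fock n N pos),
        (∀ y, D (X (Sum.inr y)) = 0) → D q = 0 := by
  classical
  obtain ⟨Y₁, hY₁, h₁⟩ := exists_constantY_finsum
    (fun s => cnum kappa m s • (ydotD n N pos (i - 1) s - ydotD n N pos i s))
    (fun w => ((finite_support_ydotD (i - 1) w).union (finite_support_ydotD i w)).subset
      fun s hs => by
        by_contra h
        exact hs (by simp_all))
    fun s => Submodule.smul_mem _ _ (Submodule.sub_mem _ (ydotD_mem _ _) (ydotD_mem _ _))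
  obtain ⟨Y₂, hY₂, h₂⟩ := exists_constantY_finsum
    (fun s => cnum kappa m s • (ydotD n N pos (i - 1) s - (2 : ℂ) • ydotD n N pos i s
      + ydotD n N pos (i + 1) s))
    (fun w => (((finite_support_ydotD (i - 1) w).union (finite_support_ydotD i w)).union
      (finite_support_ydotD (i + 1) w)).subset
      fun s hs => by
        by_contra h
        exact hs (by simp_all))
    fun s => Submodule.smul_mem _ _ (Submodule.add_mem _ (Submodule.sub_mem _ (ydotD_mem _ _)
      (Submodule.smul_mem _ _ (ydotD_mem _ _))) (ydotD_mem _ _))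
  refine ⟨theta pos (-m) • Y₁ + theta pos m • Y₂, Submodule.add_mem _
    (Submodule.smul_mem _ _ hY₁) (Submodule.smul_mem _ _ hY₂),
    (if h : (1 ≤ i ∧ i ≤ n) ∧ pos (-m) then
      X (Sum.inr (yIdx h.1 h.2)) else 0)
      - C (if m = 0 then lam i else 0), fun w => ?_, fun D hD => ?_⟩
  · simp only [Phi, Derivation.add_apply, Derivation.smul_apply, h₁, h₂, Derivation.sub_apply,
      ydotD_apply, add_sub_assoc]
    rw [sub_mul, dite_mul, zero_mul, ← smul_eq_C_mul]
    rfl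
  · rw [map_sub, derivation_C, sub_zero]
    split_ifs
    · exact hD _
    · exact map_zero D

theorem constantY_xvar {Y : Derivation ℂ (Fock n N pos) (Fock n N pos)}
    (hY : Y ∈ constantYDerivations n N pos) (i j : ℕ) (p : MM N) :
    Y (xvar n N pos i j p) = 0 := by
  unfold xvar
  split_ifs
  · exact hY.1 _
  · exact map_zero Y

theorem constantY_lowerD_comm {Y : Derivation ℂ (Fock n N pos) (Fock n N pos)}
    (hY : Y ∈ constantYDerivations n N pos) (s : ℕ) (k : MM N) (w : Fock n N pos) :
    Y (lowerD n N pos s k w) = lowerD n N pos s k (Y w) := by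
  rw [← sub_eq_zero, ← Derivation.commutator_apply]
  suffices h : ⁅Y, lowerD n N pos s k⁆ = 0 by rw [h, Derivation.zero_apply]
  refine derivation_ext fun z => ?_
  rw [Derivation.commutator_apply, Derivation.zero_apply]
  rcases z with x | y
  · rw [hY.1, ← xvar_eq_X, lowerD_xvar _ _ _ _ _ x.1.2]
    split_ifs <;> simp [constantY_xvar hY]
  · obtain ⟨c, hc⟩ := hY.2 y
    rw [hc]
    simp [lowerD, mkDerivation_X]

theorem rootWeight_eq_Acar {r s : ℕ} (hr : 1 ≤ r) (hrn : r ≤ n) (hs : 1 ≤ s) (hsn : s ≤ n) :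
    rootWeight r s (s + 1) = Acar n r s := by
  have hmod : ∀ a b : ℕ, a ≤ n → 1 ≤ b → b ≤ n →
      ((a + 1) % (n + 1) = b % (n + 1) ↔ a + 1 = b) := by
    intro a b ha hb hbn
    rw [Nat.mod_eq_of_lt (show b < n + 1 by omega)]
    rcases ha.lt_or_eq with h | rfl
    · rw [Nat.mod_eq_of_lt (by omega)]
    · rw [Nat.mod_self]
      omega
  simp only [rootWeight, Acar, AcarZ, hmod r s hrn hs hsn, hmod s r hsn hr hrn]
  split_ifs <;> first | omega | norm_num

end Derivations

/-- For all `1 ≤ r, s ≤ n` and `m, n ∈ ℤ^{N+1}`,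
`[ρ(H_r)_m, ρ(F_s)_n] = -Â_{rs} ρ(F_s)_{m+n}` as operators on `V`. -/
theorem stmt12 (n N : ℕ) (hn : 2 ≤ n) (hN : 1 ≤ N)
    (pos : MM N → Prop)
    (hadd : ∀ a b : MM N, pos a → pos b → pos (a + b))
    (htri : ∀ a : MM N, pos a ∨ a = 0 ∨ pos (-a))
    (hzero : ¬ pos (0 : MM N))
    (hdisj : ∀ a : MM N, pos a → ¬ pos (-a))
    (kappa : MM N → Fin (N + 1) → ℂ) (lam : ℕ → ℂ)
    (hE1 : ∀ m : MM N, ∑ p : Fin (N + 1), (m p : ℂ) * kappa m p = 0)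
    (hE2 : ∀ m k : MM N, pos m → pos k →
      ∑ p : Fin (N + 1), (m p : ℂ) * kappa (-m - k) p = 0) :
    ∀ r s : ℕ, 1 ≤ r → r ≤ n → 1 ≤ s → s ≤ n → ∀ m mm : MM N,
      comm (rhoH n N pos kappa lam r m) (rhoF n N pos s mm)
        = (-(Acar n r s)) • rhoF n N pos s (m + mm) := by
  intro r s hr hrn hs hsn m k
  obtain ⟨Y, hY, q, hPhi, hq⟩ :=
    exists_Phi_apply (n := n) (pos := pos) kappa lam r m
  have hqF : lowerD n N pos s k q = 0 :=
    hq _ fun y => by rw [lowerD, MvPolynomial.mkDerivation_X]; rfl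
  ext1 w
  have hcomm := commutator_weightD_lowerD (pos := pos) r s m k w
  rw [sub_eq_iff_eq_add] at hcomm
  simp only [comm, rhoH, if_neg (Nat.one_le_iff_ne_zero.mp hr), Pi.smul_apply, rhoHn_apply _ _ r hr,
    rhoF_apply, hPhi, map_sub, map_add, map_neg, Derivation.leibniz, weightD_xvar,
    constantY_xvar hY, constantY_lowerD_comm hY, hqF, hcomm, rootWeight_eq_Acar hr hrn hs hsn,
    smul_eq_mul, MvPolynomial.smul_eq_C_mul, add_comm k m]
  ring

end Stmt12
end
end

section
/- For all 0 ≤ k ≤ n and all m, n ∈ ℤ^{N+1}, [ρ(H_k)_m, ρ(F_0)_n] = −Â_{k0} ρ(F_0)_{m+n} as operators on V; explicitly, the bracket is ρ(F_0)_{m+n} when k ≡ ±1 (mod n+1) (i.e. k = 1 or k = n), is −2ρ(F_0)_{m+n} when k = 0, and vanishes otherwise. -/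
noncomputable section

namespace Stmt13

/-- Multi-indices `m ∈ ℤ^{N+1}`. -/
abbrev MM (N : ℕ) := Fin (N + 1) → ℤ

/-- Index type for the polynomial variables `x_{ij}(m)`, `1 ≤ i < j ≤ n+1`. -/
def XIdx (n N : ℕ) := {ij : ℕ × ℕ // 1 ≤ ij.1 ∧ ij.1 < ij.2 ∧ ij.2 ≤ n + 1} × MM N

/-- Index type for the polynomial variables `y_i(k)`, `1 ≤ i ≤ n`, `k > 0`. -/
def YIdx (n N : ℕ) (pos : MM N → Prop) :=
  {i : ℕ // 1 ≤ i ∧ i ≤ n} × {k : MM N // pos k}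

/-- The Fock space `V = ℂ[x] ⊗ ℂ[y]`, realized as the polynomial ring in the
two (disjoint) families of variables. -/
abbrev Fock (n N : ℕ) (pos : MM N → Prop) :=
  MvPolynomial (XIdx n N ⊕ YIdx n N pos) ℂ

/-- `a_{ij,m}`: multiplication by `-x_{ij}(m)` (and `0` for out-of-range indices). -/
def aop (n N : ℕ) (pos : MM N → Prop) (i j : ℕ) (m : MM N) :
    Fock n N pos → Fock n N pos := fun w =>
  if h : 1 ≤ i ∧ i < j ∧ j ≤ n + 1 then
    -(MvPolynomial.X (Sum.inl ((⟨(i, j), h⟩, m) : XIdx n N)) : Fock n N pos) * w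
  else 0

/-- `a*_{ij,m}`: the partial derivative `∂/∂x_{ij}(-m)` (and `0` for
out-of-range indices). -/
def astar (n N : ℕ) (pos : MM N → Prop) (i j : ℕ) (m : MM N) :
    Fock n N pos → Fock n N pos := fun w =>
  if h : 1 ≤ i ∧ i < j ∧ j ≤ n + 1 then
    MvPolynomial.pderiv (Sum.inl ((⟨(i, j), h⟩, -m) : XIdx n N)) w
  else 0

/-- `(κ·D a*_{ij})_v := Σ_{q ∈ ℤ^{N+1}} Σ_{p=0}^N κ_{q-v,p}(-q_p) a*_{ij,q}`,
a pointwise locally finite sum of operators. -/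
def kD (n N : ℕ) (pos : MM N → Prop) (kappa : MM N → Fin (N + 1) → ℂ)
    (i j : ℕ) (v : MM N) : Fock n N pos → Fock n N pos := fun w =>
  ∑ᶠ q : MM N,
    (∑ p : Fin (N + 1), kappa (q - v) p * (-(q p : ℂ))) • astar n N pos i j q w

open Classical in
/-- `θ(m) = 1` if `m > 0` and `0` otherwise. -/
def theta {N : ℕ} (pos : MM N → Prop) (m : MM N) : ℂ := if pos m then 1 else 0

open Classical in
/-- `∂/∂y_i(s)`, with the convention that it is `0` unless `1 ≤ i ≤ n` and `s > 0`. -/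
def ydot (n N : ℕ) (pos : MM N → Prop) (i : ℕ) (s : MM N) :
    Fock n N pos → Fock n N pos := fun w =>
  if h : (1 ≤ i ∧ i ≤ n) ∧ pos s then
    MvPolynomial.pderiv (Sum.inr ((⟨i, h.1⟩, ⟨s, h.2⟩) : YIdx n N pos)) w
  else 0

/-- `Σ_{p=0}^N m_p κ_{-m+s,p}`. -/
def cnum {N : ℕ} (kappa : MM N → Fin (N + 1) → ℂ) (m s : MM N) : ℂ :=
  ∑ p : Fin (N + 1), (m p : ℂ) * kappa (-m + s) p

open Classical in
/-- The operator `Φ(b_i(m))` (for `1 ≤ i ≤ n`), acting on `V`. -/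
def Phi (n N : ℕ) (pos : MM N → Prop) (kappa : MM N → Fin (N + 1) → ℂ)
    (lam : ℕ → ℂ) (i : ℕ) (m : MM N) : Fock n N pos → Fock n N pos := fun w =>
  theta pos (-m) • (∑ᶠ s : MM N, cnum kappa m s •
      (ydot n N pos (i - 1) s w - ydot n N pos i s w))
  + theta pos m • (∑ᶠ s : MM N, cnum kappa m s •
      (ydot n N pos (i - 1) s w - (2 : ℂ) • ydot n N pos i s w
        + ydot n N pos (i + 1) s w))
  + (if h : (1 ≤ i ∧ i ≤ n) ∧ pos (-m) then
      (MvPolynomial.X (Sum.inr ((⟨i, h.1⟩, ⟨-m, h.2⟩) : YIdx n N pos)) :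
          Fock n N pos) * w
    else 0)
  - (if m = 0 then lam i else 0) • w

/-- `Φ(b_0(m)) := -Σ_{i=1}^n Φ(b_i(m))`, and `Φ(b_i(m))` for `1 ≤ i ≤ n`. -/
def PhiHat (n N : ℕ) (pos : MM N → Prop) (kappa : MM N → Fin (N + 1) → ℂ)
    (lam : ℕ → ℂ) (i : ℕ) (m : MM N) : Fock n N pos → Fock n N pos :=
  if i = 0 then -(∑ r ∈ Finset.Icc 1 n, Phi n N pos kappa lam r m)
  else Phi n N pos kappa lam i m

/-- The `m`-th mode of the product of two families of operators:
`(XY)_m := Σ_{k+l=m} X_k Y_l` (pointwise locally finite sum). -/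
def fmul (n N : ℕ) (pos : MM N → Prop)
    (X Y : MM N → Fock n N pos → Fock n N pos) :
    MM N → Fock n N pos → Fock n N pos :=
  fun m w => ∑ᶠ k : MM N, X k (Y (m - k) w)

/-- Modewise product of a finite list of families of operators; the empty
product is the identity family (the delta family supported at `0`). -/
def fprod (n N : ℕ) (pos : MM N → Prop) :
    List (MM N → Fock n N pos → Fock n N pos) →
      MM N → Fock n N pos → Fock n N pos
  | [] => fun m w => if m = 0 then w else 0
  | X :: L => fmul n N pos X (fprod n N pos L)

/-- The affine Cartan matrix of type `A_n^{(1)}` (indices `0 ≤ i, j ≤ n`), as an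
integer matrix. -/
def AcarZ (n i j : ℕ) : ℤ :=
  if i = j then 2
  else if (i + 1) % (n + 1) = j % (n + 1) ∨ (j + 1) % (n + 1) = i % (n + 1) then -1
  else 0

/-- The affine Cartan matrix of type `A_n^{(1)}`, with complex entries. -/
def Acar (n i j : ℕ) : ℂ := (AcarZ n i j : ℂ)

/-- `ρ(F_r)_m` for `1 ≤ r ≤ n`. -/
def rhoF (n N : ℕ) (pos : MM N → Prop) (r : ℕ) (m : MM N) :
    Fock n N pos → Fock n N pos :=
  aop n N pos r (r + 1) m
    - ∑ j ∈ Finset.Ico 1 r, fmul n N pos (aop n N pos j (r + 1)) (astar n N pos j r) m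

/-- `ρ(H_r)_m` for `1 ≤ r ≤ n`. -/
def rhoHn (n N : ℕ) (pos : MM N → Prop) (kappa : MM N → Fin (N + 1) → ℂ)
    (lam : ℕ → ℂ) (r : ℕ) (m : MM N) : Fock n N pos → Fock n N pos :=
  (2 : ℂ) • fmul n N pos (aop n N pos r (r + 1)) (astar n N pos r (r + 1)) m
  + ∑ i ∈ Finset.Ico 1 r,
      (fmul n N pos (aop n N pos i (r + 1)) (astar n N pos i (r + 1)) m
        - fmul n N pos (aop n N pos i r) (astar n N pos i r) m)
  + ∑ j ∈ Finset.Icc (r + 2) (n + 1),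
      (fmul n N pos (aop n N pos r j) (astar n N pos r j) m
        - fmul n N pos (aop n N pos (r + 1) j) (astar n N pos (r + 1) j) m)
  + Phi n N pos kappa lam r m

/-- `ρ(H_r)_m` for `0 ≤ r ≤ n`, with `ρ(H_0)_m := -Σ_{r=1}^n ρ(H_r)_m`. -/
def rhoH (n N : ℕ) (pos : MM N → Prop) (kappa : MM N → Fin (N + 1) → ℂ)
    (lam : ℕ → ℂ) (r : ℕ) (m : MM N) : Fock n N pos → Fock n N pos :=
  if r = 0 then -(∑ s ∈ Finset.Icc 1 n, rhoHn n N pos kappa lam s m)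
  else rhoHn n N pos kappa lam r m

/-- `ρ(E_r)_m` for `1 ≤ r ≤ n`. -/
def rhoEn (n N : ℕ) (pos : MM N → Prop) (kappa : MM N → Fin (N + 1) → ℂ)
    (lam : ℕ → ℂ) (r : ℕ) (m : MM N) : Fock n N pos → Fock n N pos :=
  fmul n N pos (aop n N pos r (r + 1))
      (fmul n N pos (astar n N pos r (r + 1)) (astar n N pos r (r + 1))) m
  - ∑ j ∈ Finset.Icc (r + 2) (n + 1),
      fmul n N pos (aop n N pos (r + 1) j) (astar n N pos r j) m
  + ∑ j ∈ Finset.Ico 1 r,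
      fmul n N pos (aop n N pos j r) (astar n N pos j (r + 1)) m
  + ∑ j ∈ Finset.Icc (r + 2) (n + 1),
      (fmul n N pos (fmul n N pos (aop n N pos r j) (astar n N pos r j))
          (astar n N pos r (r + 1)) m
        - fmul n N pos (fmul n N pos (aop n N pos (r + 1) j) (astar n N pos (r + 1) j))
            (astar n N pos r (r + 1)) m)
  + fmul n N pos (astar n N pos r (r + 1)) (Phi n N pos kappa lam r) m
  + kD n N pos kappa r (r + 1) m

/-- `ρ(E_r)_m` for `0 ≤ r ≤ n`, with `ρ(E_0)_m := -a_{1,n+1;m}`. -/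
def rhoE (n N : ℕ) (pos : MM N → Prop) (kappa : MM N → Fin (N + 1) → ℂ)
    (lam : ℕ → ℂ) (r : ℕ) (m : MM N) : Fock n N pos → Fock n N pos :=
  if r = 0 then -(aop n N pos 1 (n + 1) m) else rhoEn n N pos kappa lam r m

/-- The strictly increasing sequence `1 = q_1 < q_2 < ⋯ < q_i` encoded by a
subset `s ⊆ {2,…,n+1}`, as the sorted list `1 :: sort s`. -/
def ql (s : Finset ℕ) : List ℕ := 1 :: s.sort (· ≤ ·)

/-- The last entry `q_i` of the sequence encoded by `s`. -/
def qend (s : Finset ℕ) : ℕ := ((ql s).getLast?).getD 0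

/-- The second-to-last entry `q_{i-1}` of the sequence encoded by `s`
(`0` if the sequence has length `1`, so that the condition `q_{i-1} ≤ r` is
vacuous in that case). -/
def qpen (s : Finset ℕ) : ℕ := (((ql s).dropLast).getLast?).getD 0

/-- The list of adjacent pairs `(q_l, q_{l+1})` of a list. -/
def qpairs (l : List ℕ) : List (ℕ × ℕ) := l.zip l.tail

/-- `ρ(F_0)_m`. -/
def rhoF0 (n N : ℕ) (pos : MM N → Prop) (kappa : MM N → Fin (N + 1) → ℂ)
    (lam : ℕ → ℂ) (m : MM N) : Fock n N pos → Fock n N pos :=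
  -(∑ r ∈ Finset.Icc 1 (n + 1), ∑ j ∈ Finset.Icc 1 (n + 1),
      ∑ s ∈ (Finset.Icc 2 (n + 1)).powerset,
        if r < j ∧ qend s = j ∧ qpen s ≤ r then
          fprod n N pos
            (aop n N pos r j ::
              ((qpairs (ql s)).map fun p => astar n N pos p.1 p.2)
                ++ [astar n N pos r (n + 1)]) m
        else 0)
  - (∑ r ∈ Finset.Icc 1 n, ∑ s ∈ (Finset.Icc 2 (n + 1)).powerset,
      if qend s ≤ r then
        fprod n N pos
          (((qpairs (ql s ++ [n + 1])).map fun p => astar n N pos p.1 p.2)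
            ++ [Phi n N pos kappa lam r]) m
      else 0)
  - (∑ r ∈ Finset.Icc 1 n, ∑ s ∈ (Finset.Icc 2 (n + 1)).powerset,
      if qend s = r then
        fprod n N pos
          (((qpairs (ql s)).map fun p => astar n N pos p.1 p.2)
            ++ [kD n N pos kappa r (n + 1)]) m
      else 0)

/-- `ρ(F_r)_m` for `0 ≤ r ≤ n`. -/
def rhoFa (n N : ℕ) (pos : MM N → Prop) (kappa : MM N → Fin (N + 1) → ℂ)
    (lam : ℕ → ℂ) (r : ℕ) (m : MM N) : Fock n N pos → Fock n N pos :=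
  if r = 0 then rhoF0 n N pos kappa lam m else rhoF n N pos r m

/-- The commutator of two operators. -/
def comm {V : Type*} [AddCommGroup V] (f g : V → V) : V → V :=
  fun w => f (g w) - g (f w)

section LocallyFinite

variable {V ι : Type*} [AddCommGroup V]

/-- A family of operators is locally finite if only finitely many members act nontrivially
on any given vector. -/
def LocFin (T : ι → V → V) : Prop := ∀ w, (Function.support fun s => T s w).Finite

theorem comm_swap (f g : V → V) : comm f g = -comm g f := by
  funext w
  simp [comm]

theorem locFin_add {T T' : ι → V → V} (hT : LocFin T) (hT' : LocFin T') :
    LocFin fun s => T s + T' s := fun w =>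
  ((hT w).union (hT' w)).subset (Function.support_add _ _)

variable [Module ℂ V]

theorem comm_comp {A B C : V → V} (hB : IsLinearMap ℂ B) (w : V) :
    comm A (B ∘ C) w = comm A B (C w) + B (comm A C w) := by
  simp only [comm, Function.comp, hB.map_sub]
  abel

theorem comm_add_left {f f' g : V → V} (hg : IsLinearMap ℂ g) :
    comm (f + f') g = comm f g + comm f' g := by
  funext w
  simp only [comm, Pi.add_apply, hg.map_add]
  abel

theorem comm_sub_left {f f' g : V → V} (hg : IsLinearMap ℂ g) :
    comm (f - f') g = comm f g - comm f' g := by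
  funext w
  simp only [comm, Pi.sub_apply, hg.map_sub]
  abel

theorem comm_neg_left {f g : V → V} (hg : IsLinearMap ℂ g) :
    comm (-f) g = -comm f g := by
  funext w
  simp only [comm, Pi.neg_apply, hg.map_neg]
  abel

theorem comm_smul_left {f g : V → V} (c : ℂ) (hg : IsLinearMap ℂ g) :
    comm (c • f) g = c • comm f g := by
  funext w
  simp only [comm, Pi.smul_apply, hg.map_smul, smul_sub]

theorem comm_sum_left {s : Finset ι} {f : ι → V → V} {g : V → V} (hg : IsLinearMap ℂ g) :
    comm (∑ i ∈ s, f i) g = ∑ i ∈ s, comm (f i) g := by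
  funext w
  have h : g (∑ i ∈ s, f i w) = ∑ i ∈ s, g (f i w) := map_sum (hg.mk' g) _ _
  simp only [comm, Finset.sum_apply, h, Finset.sum_sub_distrib]

theorem comm_add_right {f g g' : V → V} (hf : IsLinearMap ℂ f) :
    comm f (g + g') = comm f g + comm f g' := by
  rw [comm_swap, comm_add_left hf, neg_add, ← comm_swap, ← comm_swap]

theorem comm_sub_right {f g g' : V → V} (hf : IsLinearMap ℂ f) :
    comm f (g - g') = comm f g - comm f g' := by
  rw [comm_swap, comm_sub_left hf, comm_swap f g, comm_swap f g']
  abel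

theorem comm_neg_right {f g : V → V} (hf : IsLinearMap ℂ f) :
    comm f (-g) = -comm f g := by
  rw [comm_swap, comm_neg_left hf, ← comm_swap]

theorem comm_smul_right {f g : V → V} (c : ℂ) (hf : IsLinearMap ℂ f) :
    comm f (c • g) = c • comm f g := by
  rw [comm_swap, comm_smul_left c hf, ← smul_neg, ← comm_swap]

theorem comm_sum_right {s : Finset ι} {f : V → V} {g : ι → V → V} (hf : IsLinearMap ℂ f) :
    comm f (∑ i ∈ s, g i) = ∑ i ∈ s, comm f (g i) := by
  rw [comm_swap, comm_sum_left hf, ← Finset.sum_neg_distrib]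
  exact Finset.sum_congr rfl fun i _ => (comm_swap _ _).symm

theorem comm_zero_right {f : V → V} (hf : IsLinearMap ℂ f) : comm f 0 = 0 := by
  funext w
  simp [comm, hf.map_zero]

theorem comm_zero_left {g : V → V} (hg : IsLinearMap ℂ g) : comm 0 g = 0 := by
  funext w
  simp [comm, hg.map_zero]

theorem isLinearMap_add {f g : V → V} (hf : IsLinearMap ℂ f) (hg : IsLinearMap ℂ g) :
    IsLinearMap ℂ (f + g) := (hf.mk' f + hg.mk' g).isLinear

theorem isLinearMap_sub {f g : V → V} (hf : IsLinearMap ℂ f) (hg : IsLinearMap ℂ g) :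
    IsLinearMap ℂ (f - g) := (hf.mk' f - hg.mk' g).isLinear

theorem isLinearMap_zero : IsLinearMap ℂ (0 : V → V) := (0 : V →ₗ[ℂ] V).isLinear

theorem isLinearMap_const_smul {f : V → V} (c : ℂ) (hf : IsLinearMap ℂ f) :
    IsLinearMap ℂ (c • f) := (c • hf.mk' f).isLinear

theorem isLinearMap_comp {f g : V → V} (hf : IsLinearMap ℂ f) (hg : IsLinearMap ℂ g) :
    IsLinearMap ℂ (f ∘ g) := (hf.mk' f ∘ₗ hg.mk' g).isLinear

theorem isLinearMap_sum {s : Finset ι} {f : ι → V → V} (hf : ∀ i, IsLinearMap ℂ (f i)) :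
    IsLinearMap ℂ (∑ i ∈ s, f i) := by
  classical
  induction s using Finset.induction_on with
  | empty => simpa using isLinearMap_zero
  | insert a s ha ih =>
    rw [Finset.sum_insert ha]
    exact isLinearMap_add (hf a) ih

theorem isLinearMap_finsum {T : ι → V → V} (hT : ∀ s, IsLinearMap ℂ (T s)) (hf : LocFin T) :
    IsLinearMap ℂ (fun w => ∑ᶠ s, T s w) where
  map_add x y := by
    rw [← finsum_add_distrib (hf x) (hf y)]
    exact finsum_congr fun s => (hT s).map_add x y
  map_smul c x := by
    rw [smul_finsum]
    exact finsum_congr fun s => (hT s).map_smul c x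

theorem finite_support_of_map {A : V → V} (hA : IsLinearMap ℂ A) {f : ι → V}
    (hf : (Function.support f).Finite) : (Function.support fun s => A (f s)).Finite :=
  hf.subset fun s hs h => hs (by simp only [h, hA.map_zero])

theorem isLinearMap_apply_finsum {A : V → V} (hA : IsLinearMap ℂ A) {f : ι → V}
    (hf : (Function.support f).Finite) : A (∑ᶠ s, f s) = ∑ᶠ s, A (f s) :=
  (hA.mk' A).toAddMonoidHom.map_finsum hf

theorem locFin_comm {A : V → V} (hA : IsLinearMap ℂ A) {T : ι → V → V} (hT : LocFin T) :
    LocFin fun s => comm A (T s) := fun w =>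
  ((finite_support_of_map hA (hT w)).union (hT (A w))).subset
    (Function.support_sub (fun s => A (T s w)) fun s => T s (A w))

theorem comm_finsum {A : V → V} (hA : IsLinearMap ℂ A) {T : ι → V → V} (hT : LocFin T) :
    comm A (fun w => ∑ᶠ s, T s w) = fun w => ∑ᶠ s, comm A (T s) w := by
  funext w
  simp only [comm]
  rw [finsum_sub_distrib (finite_support_of_map hA (hT w)) (hT (A w)),
    isLinearMap_apply_finsum hA (hT w)]

theorem comm_finsum_eq_zero {A : V → V} (hA : IsLinearMap ℂ A) {T : ι → V → V} (hT : LocFin T)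
    (h : ∀ s, comm A (T s) = 0) : comm A (fun w => ∑ᶠ s, T s w) = 0 := by
  rw [comm_finsum hA hT]
  funext w
  simp [h]

theorem locFin_smul {T : ι → V → V} (c : ι → ℂ) (hT : LocFin T) :
    LocFin fun s => c s • T s := fun w =>
  (hT w).subset (Function.support_smul_subset_right _ _)

end LocallyFinite

section Products

variable {n N : ℕ} {pos : MM N → Prop}

/-- The sum defining each mode of the product of `X` and `Y` is locally finite. -/
def ProdFinite (X Y : MM N → Fock n N pos → Fock n N pos) : Prop :=
  ∀ v, LocFin fun k => X k ∘ Y (v - k)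

theorem prodFinite_of_locFin_right {X Y : MM N → Fock n N pos → Fock n N pos}
    (hX : ∀ k, IsLinearMap ℂ (X k)) (hY : LocFin Y) : ProdFinite X Y := fun v w => by
  refine ((hY w).preimage (f := fun k => v - k) sub_right_injective.injOn).subset fun k hk h => hk ?_
  simp only [Function.comp, h, (hX k).map_zero]

theorem prodFinite_of_comm {X Y : MM N → Fock n N pos → Fock n N pos}
    (hY : ∀ k, IsLinearMap ℂ (Y k)) (hX : LocFin X) (h : ∀ k l, comm (X k) (Y l) = 0) :
    ProdFinite X Y := fun v w => by
  refine (hX w).subset fun k hk h' => hk ?_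
  have := congrFun (h k (v - k)) w
  simp only [comm, h', (hY _).map_zero, sub_zero] at this
  exact this

theorem isLinearMap_fmul {X Y : MM N → Fock n N pos → Fock n N pos}
    (hX : ∀ k, IsLinearMap ℂ (X k)) (hY : ∀ k, IsLinearMap ℂ (Y k)) (h : ProdFinite X Y) (v : MM N) :
    IsLinearMap ℂ (fmul n N pos X Y v) :=
  isLinearMap_finsum (fun k => isLinearMap_comp (hX k) (hY _)) (h v)

theorem comm_fmul {A : Fock n N pos → Fock n N pos} (hA : IsLinearMap ℂ A)
    {X Y : MM N → Fock n N pos → Fock n N pos}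
    (hX : ∀ k, IsLinearMap ℂ (X k)) (h : ProdFinite X Y) (v : MM N) :
    comm A (fmul n N pos X Y v) =
      fun w => ∑ᶠ k, (comm A (X k) (Y (v - k) w) + X k (comm A (Y (v - k)) w)) := by
  refine (comm_finsum hA (h v)).trans ?_
  funext w
  exact finsum_congr fun k => comm_comp (hX k) w

theorem comm_fmul_eq_zero {A : Fock n N pos → Fock n N pos} (hA : IsLinearMap ℂ A)
    {X Y : MM N → Fock n N pos → Fock n N pos}
    (hX : ∀ k, IsLinearMap ℂ (X k)) (h : ProdFinite X Y)
    (hAX : ∀ k, comm A (X k) = 0) (hAY : ∀ k, comm A (Y k) = 0) (v : MM N) :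
    comm A (fmul n N pos X Y v) = 0 := by
  rw [comm_fmul hA hX h]
  funext w
  simp [hAX, hAY, (hX _).map_zero]

theorem fmul_smul_right {X Y : MM N → Fock n N pos → Fock n N pos}
    (hX : ∀ k, IsLinearMap ℂ (X k)) (c : ℂ) (v : MM N) :
    fmul n N pos X (c • Y) v = c • fmul n N pos X Y v := by
  funext w
  simp only [fmul, Pi.smul_apply, smul_finsum, (hX _).map_smul]

theorem fmul_zero_right {X : MM N → Fock n N pos → Fock n N pos}
    (hX : ∀ k, IsLinearMap ℂ (X k)) : fmul n N pos X 0 = 0 := by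
  funext v w
  simp [fmul, (hX _).map_zero]

theorem fmul_shift_right {X Y : MM N → Fock n N pos → Fock n N pos} (m v : MM N) :
    fmul n N pos X (fun u => Y (u + m)) v = fmul n N pos X Y (v + m) := by
  funext w
  simp only [fmul, sub_add_eq_add_sub]

theorem fmul_shift_left {X Y : MM N → Fock n N pos → Fock n N pos} (m v : MM N) :
    fmul n N pos (fun u => X (u + m)) Y v = fmul n N pos X Y (v + m) := by
  funext w
  simp only [fmul]
  rw [← finsum_comp_equiv (Equiv.addRight m) (f := fun k => X k (Y (v + m - k) w))]
  simp

theorem fmul_add_right {X Y Y' : MM N → Fock n N pos → Fock n N pos}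
    (hX : ∀ k, IsLinearMap ℂ (X k)) (h : ProdFinite X Y) (h' : ProdFinite X Y') :
    fmul n N pos X (Y + Y') = fmul n N pos X Y + fmul n N pos X Y' := by
  funext v w
  refine Eq.trans (finsum_congr fun k => (hX k).map_add _ _) ?_
  exact finsum_add_distrib (h v w) (h' v w)

/-- A commutator with a product whose left factor is homogeneous of weight `c`. -/
theorem comm_fmul_of_weight {A : Fock n N pos → Fock n N pos} (hA : IsLinearMap ℂ A)
    {X Y : MM N → Fock n N pos → Fock n N pos} {c : ℂ} {m : MM N}
    (hX : ∀ k, IsLinearMap ℂ (X k)) (h : ProdFinite X Y)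
    (hAX : ∀ k, comm A (X k) = c • X (k + m)) (v : MM N) :
    comm A (fmul n N pos X Y v) =
      c • fmul n N pos X Y (v + m) + fmul n N pos X (fun k => comm A (Y k)) v := by
  rw [comm_fmul hA hX h]
  funext w
  have h1 : (Function.support fun k => comm A (X k) (Y (v - k) w)).Finite := by
    refine ((h (v + m) w).preimage (f := fun k => k + m) (add_left_injective m).injOn).subset
      fun k hk h' => hk ?_
    simp only [Function.comp, add_sub_add_right_eq_sub] at h'
    simp [hAX, h']
  have h2 : (Function.support fun k => X k (comm A (Y (v - k)) w)).Finite := by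
    refine ((locFin_comm hA (h v) w).union h1).subset fun k hk => ?_
    by_contra hc
    rw [Set.mem_union, not_or, Function.notMem_support, Function.notMem_support] at hc
    have hk' := comm_comp (A := A) (C := Y (v - k)) (hX k) w
    rw [hc.2, zero_add] at hk'
    exact hk (hk'.symm.trans hc.1)
  rw [finsum_add_distrib h1 h2, ← fmul_shift_left]
  simp only [hAX, Pi.smul_apply, ← smul_finsum]
  rfl

/-- Weights add up in products. -/
theorem comm_fmul_of_weights {A : Fock n N pos → Fock n N pos} (hA : IsLinearMap ℂ A)
    {X Y : MM N → Fock n N pos → Fock n N pos} {c d : ℂ} {m : MM N}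
    (hX : ∀ k, IsLinearMap ℂ (X k)) (h : ProdFinite X Y)
    (hAX : ∀ k, comm A (X k) = c • X (k + m)) (hAY : ∀ k, comm A (Y k) = d • Y (k + m))
    (v : MM N) :
    comm A (fmul n N pos X Y v) = (c + d) • fmul n N pos X Y (v + m) := by
  have hY : (fun k => comm A (Y k)) = d • fun k => Y (k + m) := funext hAY
  rw [comm_fmul_of_weight hA hX h hAX, hY, fmul_smul_right hX, fmul_shift_right, add_smul]

end Products

section Generators

variable {n N : ℕ} {pos : MM N → Prop}

/-- The variable `x_{ij}(m)`. -/
def xvar (pos : MM N → Prop) {i j : ℕ} (h : 1 ≤ i ∧ i < j ∧ j ≤ n + 1) (m : MM N) :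
    XIdx n N ⊕ YIdx n N pos := Sum.inl (⟨(i, j), h⟩, m)

/-- The variable `y_i(s)`. -/
def yvar {i : ℕ} {s : MM N} (h : (1 ≤ i ∧ i ≤ n) ∧ pos s) :
    XIdx n N ⊕ YIdx n N pos := Sum.inr (⟨i, h.1⟩, ⟨s, h.2⟩)

theorem xvar_inj {i j p q : ℕ} (h : 1 ≤ i ∧ i < j ∧ j ≤ n + 1) (h' : 1 ≤ p ∧ p < q ∧ q ≤ n + 1)
    (m k : MM N) : xvar pos h m = xvar pos h' k ↔ (i = p ∧ j = q) ∧ m = k := by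
  refine ⟨fun e => ?_, ?_⟩
  · have := Prod.mk.inj (Sum.inl.inj e)
    exact ⟨Prod.mk.inj (Subtype.mk.inj this.1), this.2⟩
  · rintro ⟨⟨rfl, rfl⟩, rfl⟩
    rfl

theorem yvar_inj {i p : ℕ} {s t : MM N} (h : (1 ≤ i ∧ i ≤ n) ∧ pos s)
    (h' : (1 ≤ p ∧ p ≤ n) ∧ pos t) : yvar h = yvar h' ↔ i = p ∧ s = t := by
  refine ⟨fun e => ?_, ?_⟩
  · have := Prod.mk.inj (Sum.inr.inj e)
    exact ⟨Subtype.mk.inj this.1, Subtype.mk.inj this.2⟩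
  · rintro ⟨rfl, rfl⟩
    rfl

theorem xvar_ne_yvar {i j p : ℕ} {s : MM N} (h : 1 ≤ i ∧ i < j ∧ j ≤ n + 1) (m : MM N)
    (h' : (1 ≤ p ∧ p ≤ n) ∧ pos s) : xvar pos h m ≠ yvar h' := Sum.inl_ne_inr

theorem astar_eq_pderiv {i j : ℕ} (h : 1 ≤ i ∧ i < j ∧ j ≤ n + 1) (m : MM N) :
    astar n N pos i j m = fun w => MvPolynomial.pderiv (xvar pos h (-m)) w :=
  funext fun _ => dif_pos h

theorem astar_eq_zero {i j : ℕ} (h : ¬ (1 ≤ i ∧ i < j ∧ j ≤ n + 1)) (m : MM N) :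
    astar n N pos i j m = 0 := funext fun _ => dif_neg h

theorem aop_eq_mul {i j : ℕ} (h : 1 ≤ i ∧ i < j ∧ j ≤ n + 1) (m : MM N) :
    aop n N pos i j m = fun w => -MvPolynomial.X (xvar pos h m) * w :=
  funext fun _ => dif_pos h

theorem aop_eq_zero {i j : ℕ} (h : ¬ (1 ≤ i ∧ i < j ∧ j ≤ n + 1)) (m : MM N) :
    aop n N pos i j m = 0 := funext fun _ => dif_neg h

theorem ydot_eq_pderiv {i : ℕ} {s : MM N} (h : (1 ≤ i ∧ i ≤ n) ∧ pos s) :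
    ydot n N pos i s = fun w => MvPolynomial.pderiv (yvar h) w :=
  funext fun _ => dif_pos h

theorem ydot_eq_zero {i : ℕ} {s : MM N} (h : ¬ ((1 ≤ i ∧ i ≤ n) ∧ pos s)) :
    ydot n N pos i s = 0 := funext fun _ => dif_neg h

theorem isLinearMap_pderiv {σ : Type*} (i : σ) :
    IsLinearMap ℂ fun w : MvPolynomial σ ℂ => MvPolynomial.pderiv i w :=
  (MvPolynomial.pderiv (R := ℂ) i).toLinearMap.isLinear

theorem isLinearMap_mul {σ : Type*} (x : MvPolynomial σ ℂ) :
    IsLinearMap ℂ fun w : MvPolynomial σ ℂ => x * w :=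
  (LinearMap.mulLeft ℂ x).isLinear

theorem comm_pderiv_pderiv {σ : Type*} (i j : σ) :
    comm (fun w : MvPolynomial σ ℂ => MvPolynomial.pderiv i w)
      (fun w => MvPolynomial.pderiv j w) = 0 := by
  classical
  have h : ⁅MvPolynomial.pderiv (R := ℂ) i, MvPolynomial.pderiv (R := ℂ) j⁆ = 0 :=
    MvPolynomial.derivation_ext fun k => by
      simp only [Derivation.commutator_apply, MvPolynomial.pderiv_X, Pi.single_apply]
      split_ifs <;> simp
  funext w
  have h' := Derivation.commutator_apply (a := w) (D1 := MvPolynomial.pderiv (R := ℂ) i)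
    (D2 := MvPolynomial.pderiv (R := ℂ) j)
  rw [h] at h'
  exact h'.symm

theorem comm_pderiv_mul {σ : Type*} (i : σ) (x w : MvPolynomial σ ℂ) :
    comm (fun w : MvPolynomial σ ℂ => MvPolynomial.pderiv i w) (fun w => x * w) w =
      MvPolynomial.pderiv i x * w := by
  simp only [comm, Derivation.leibniz, smul_eq_mul]
  ring

theorem comm_mul_mul {σ : Type*} (x y : MvPolynomial σ ℂ) :
    comm (fun w : MvPolynomial σ ℂ => x * w) (fun w => y * w) = 0 := by
  funext w
  simp only [comm, Pi.zero_apply]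
  ring

theorem finite_support_pderiv {σ ι : Type*} {f : ι → σ} (hf : Function.Injective f)
    (w : MvPolynomial σ ℂ) : (Function.support fun k => MvPolynomial.pderiv (f k) w).Finite :=
  (w.vars.finite_toSet.preimage (f := f) hf.injOn).subset fun k hk => by
    by_contra h
    exact hk (MvPolynomial.pderiv_eq_zero_of_notMem_vars h)

theorem isLinearMap_astar (i j : ℕ) (m : MM N) : IsLinearMap ℂ (astar n N pos i j m) := by
  by_cases h : 1 ≤ i ∧ i < j ∧ j ≤ n + 1
  · rw [astar_eq_pderiv h]
    exact isLinearMap_pderiv _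
  · rw [astar_eq_zero h]
    exact isLinearMap_zero

theorem isLinearMap_aop (i j : ℕ) (m : MM N) : IsLinearMap ℂ (aop n N pos i j m) := by
  by_cases h : 1 ≤ i ∧ i < j ∧ j ≤ n + 1
  · rw [aop_eq_mul h]
    exact isLinearMap_mul _
  · rw [aop_eq_zero h]
    exact isLinearMap_zero

theorem isLinearMap_ydot (i : ℕ) (s : MM N) : IsLinearMap ℂ (ydot n N pos i s) := by
  by_cases h : (1 ≤ i ∧ i ≤ n) ∧ pos s
  · rw [ydot_eq_pderiv h]
    exact isLinearMap_pderiv _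
  · rw [ydot_eq_zero h]
    exact isLinearMap_zero

theorem locFin_astar (i j : ℕ) : LocFin (astar n N pos i j) := fun w => by
  by_cases h : 1 ≤ i ∧ i < j ∧ j ≤ n + 1
  · simp only [astar_eq_pderiv h]
    refine finite_support_pderiv (fun k l hkl => ?_) w
    simpa using ((xvar_inj h h _ _).1 hkl).2
  · simp [astar_eq_zero h]

theorem locFin_ydot (i : ℕ) : LocFin (ydot n N pos i) := fun w => by
  by_cases hi : 1 ≤ i ∧ i ≤ n
  · have hf : Function.Injective fun k : {k : MM N // pos k} =>
        yvar (n := n) (⟨hi, k.2⟩ : (1 ≤ i ∧ i ≤ n) ∧ pos k) :=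
      fun k l hkl => Subtype.ext ((yvar_inj _ _).1 hkl).2
    refine ((finite_support_pderiv hf w).image Subtype.val).subset fun s hs => ?_
    by_cases h : pos s
    · rw [Function.mem_support, ydot_eq_pderiv ⟨hi, h⟩] at hs
      exact ⟨⟨s, h⟩, hs, rfl⟩
    · exact absurd (congrFun (ydot_eq_zero fun h' => h h'.2) w) hs
  · simp [ydot_eq_zero fun h' : (1 ≤ i ∧ i ≤ n) ∧ _ => hi h'.1]

theorem comm_astar_astar (i j p q : ℕ) (v k : MM N) :
    comm (astar n N pos i j v) (astar n N pos p q k) = 0 := by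
  by_cases h : 1 ≤ i ∧ i < j ∧ j ≤ n + 1
  · by_cases h' : 1 ≤ p ∧ p < q ∧ q ≤ n + 1
    · rw [astar_eq_pderiv h, astar_eq_pderiv h', comm_pderiv_pderiv]
    · rw [astar_eq_zero h', comm_zero_right (isLinearMap_astar _ _ _)]
  · rw [astar_eq_zero h, comm_zero_left (isLinearMap_astar _ _ _)]

theorem comm_astar_ydot (i j p : ℕ) (v s : MM N) :
    comm (astar n N pos i j v) (ydot n N pos p s) = 0 := by
  by_cases h : 1 ≤ i ∧ i < j ∧ j ≤ n + 1
  · by_cases h' : (1 ≤ p ∧ p ≤ n) ∧ pos s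
    · rw [astar_eq_pderiv h, ydot_eq_pderiv h', comm_pderiv_pderiv]
    · rw [ydot_eq_zero h', comm_zero_right (isLinearMap_astar _ _ _)]
  · rw [astar_eq_zero h, comm_zero_left (isLinearMap_ydot _ _)]

theorem comm_ydot_ydot (i p : ℕ) (t s : MM N) :
    comm (ydot n N pos i t) (ydot n N pos p s) = 0 := by
  by_cases h : (1 ≤ i ∧ i ≤ n) ∧ pos t
  · by_cases h' : (1 ≤ p ∧ p ≤ n) ∧ pos s
    · rw [ydot_eq_pderiv h, ydot_eq_pderiv h', comm_pderiv_pderiv]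
    · rw [ydot_eq_zero h', comm_zero_right (isLinearMap_ydot _ _)]
  · rw [ydot_eq_zero h, comm_zero_left (isLinearMap_ydot _ _)]

theorem comm_aop_aop (i j p q : ℕ) (v k : MM N) :
    comm (aop n N pos i j v) (aop n N pos p q k) = 0 := by
  by_cases h : 1 ≤ i ∧ i < j ∧ j ≤ n + 1
  · by_cases h' : 1 ≤ p ∧ p < q ∧ q ≤ n + 1
    · rw [aop_eq_mul h, aop_eq_mul h', comm_mul_mul]
    · rw [aop_eq_zero h', comm_zero_right (isLinearMap_aop _ _ _)]
  · rw [aop_eq_zero h, comm_zero_left (isLinearMap_aop _ _ _)]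

theorem comm_aop_ydot (i j p : ℕ) (v s : MM N) :
    comm (aop n N pos i j v) (ydot n N pos p s) = 0 := by
  by_cases h : 1 ≤ i ∧ i < j ∧ j ≤ n + 1
  · by_cases h' : (1 ≤ p ∧ p ≤ n) ∧ pos s
    · rw [aop_eq_mul h, ydot_eq_pderiv h', comm_swap]
      funext w
      rw [Pi.neg_apply, comm_pderiv_mul, map_neg,
        MvPolynomial.pderiv_X_of_ne (xvar_ne_yvar h v h')]
      simp
    · rw [ydot_eq_zero h', comm_zero_right (isLinearMap_aop _ _ _)]
  · rw [aop_eq_zero h, comm_zero_left (isLinearMap_ydot _ _)]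

theorem comm_astar_aop (i j p q : ℕ) (v k : MM N) (w : Fock n N pos) :
    comm (astar n N pos i j v) (aop n N pos p q k) w =
      if (1 ≤ i ∧ i < j ∧ j ≤ n + 1) ∧ (p = i ∧ q = j) ∧ k = -v then -w else 0 := by
  classical
  by_cases h : 1 ≤ i ∧ i < j ∧ j ≤ n + 1
  · by_cases h' : 1 ≤ p ∧ p < q ∧ q ≤ n + 1
    · rw [astar_eq_pderiv h, aop_eq_mul h', comm_pderiv_mul, map_neg, MvPolynomial.pderiv_X,
        Pi.single_apply]
      have := xvar_inj (pos := pos) h' h k (-v)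
      simp only [h, this, true_and, and_self]
      split_ifs <;> simp
    · rw [aop_eq_zero h', comm_zero_right (isLinearMap_astar _ _ _), if_neg]
      · rfl
      · rintro ⟨-, ⟨rfl, rfl⟩, -⟩
        exact h' h
  · rw [astar_eq_zero h, comm_zero_left (isLinearMap_aop _ _ _), if_neg fun h' => h h'.1]
    rfl

end Generators

section Heisenberg

variable {n N : ℕ} {pos : MM N → Prop}

open Classical in
/-- Multiplication by `y_r(-v)` if `1 ≤ r ≤ n` and `-v > 0`, and zero otherwise. -/
def yop (n N : ℕ) (pos : MM N → Prop) (r : ℕ) (v : MM N) : Fock n N pos → Fock n N pos :=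
  fun w => if h : (1 ≤ r ∧ r ≤ n) ∧ pos (-v) then MvPolynomial.X (yvar h) * w else 0

/-- The combination of derivatives occurring in `Φ(b_i(m))` for `m < 0`. -/
def ydiff (n N : ℕ) (pos : MM N → Prop) (i : ℕ) (s : MM N) : Fock n N pos → Fock n N pos :=
  ydot n N pos (i - 1) s - ydot n N pos i s

/-- The combination of derivatives occurring in `Φ(b_i(m))` for `m > 0`. -/
def ydiff₂ (n N : ℕ) (pos : MM N → Prop) (i : ℕ) (s : MM N) : Fock n N pos → Fock n N pos :=
  ydot n N pos (i - 1) s - (2 : ℂ) • ydot n N pos i s + ydot n N pos (i + 1) s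

/-- The first-order part of `Φ(b_i(m))`. -/
def dPhi (n N : ℕ) (pos : MM N → Prop) (kappa : MM N → Fin (N + 1) → ℂ) (i : ℕ) (m : MM N) :
    Fock n N pos → Fock n N pos :=
  theta pos (-m) • (fun w => ∑ᶠ s, (cnum kappa m s • ydiff n N pos i s) w)
    + theta pos m • (fun w => ∑ᶠ s, (cnum kappa m s • ydiff₂ n N pos i s) w)

theorem Phi_eq (kappa : MM N → Fin (N + 1) → ℂ) (lam : ℕ → ℂ) (i : ℕ) (m : MM N) :
    Phi n N pos kappa lam i m =
      dPhi n N pos kappa i m + yop n N pos i m - (if m = 0 then lam i else 0 : ℂ) • id := rfl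

theorem yop_eq_mul {r : ℕ} {v : MM N} (h : (1 ≤ r ∧ r ≤ n) ∧ pos (-v)) :
    yop n N pos r v = fun w => MvPolynomial.X (yvar h) * w := funext fun _ => dif_pos h

theorem yop_eq_zero {r : ℕ} {v : MM N} (h : ¬ ((1 ≤ r ∧ r ≤ n) ∧ pos (-v))) :
    yop n N pos r v = 0 := funext fun _ => dif_neg h

theorem isLinearMap_yop (r : ℕ) (v : MM N) : IsLinearMap ℂ (yop n N pos r v) := by
  by_cases h : (1 ≤ r ∧ r ≤ n) ∧ pos (-v)
  · rw [yop_eq_mul h]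
    exact isLinearMap_mul _
  · rw [yop_eq_zero h]
    exact isLinearMap_zero

theorem comm_astar_yop (i j r : ℕ) (m v : MM N) :
    comm (astar n N pos i j m) (yop n N pos r v) = 0 := by
  by_cases h : 1 ≤ i ∧ i < j ∧ j ≤ n + 1
  · by_cases h' : (1 ≤ r ∧ r ≤ n) ∧ pos (-v)
    · funext w
      rw [astar_eq_pderiv h, yop_eq_mul h', comm_pderiv_mul,
        MvPolynomial.pderiv_X_of_ne (xvar_ne_yvar h _ h').symm]
      simp
    · rw [yop_eq_zero h', comm_zero_right (isLinearMap_astar _ _ _)]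
  · rw [astar_eq_zero h, comm_zero_left (isLinearMap_yop _ _)]

theorem comm_aop_yop (i j r : ℕ) (m v : MM N) :
    comm (aop n N pos i j m) (yop n N pos r v) = 0 := by
  by_cases h : 1 ≤ i ∧ i < j ∧ j ≤ n + 1
  · by_cases h' : (1 ≤ r ∧ r ≤ n) ∧ pos (-v)
    · rw [aop_eq_mul h, yop_eq_mul h', comm_mul_mul]
    · rw [yop_eq_zero h', comm_zero_right (isLinearMap_aop _ _ _)]
  · rw [aop_eq_zero h, comm_zero_left (isLinearMap_yop _ _)]

theorem comm_yop_yop (i r : ℕ) (m v : MM N) :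
    comm (yop n N pos i m) (yop n N pos r v) = 0 := by
  by_cases h : (1 ≤ i ∧ i ≤ n) ∧ pos (-m)
  · by_cases h' : (1 ≤ r ∧ r ≤ n) ∧ pos (-v)
    · rw [yop_eq_mul h, yop_eq_mul h', comm_mul_mul]
    · rw [yop_eq_zero h', comm_zero_right (isLinearMap_yop _ _)]
  · rw [yop_eq_zero h, comm_zero_left (isLinearMap_yop _ _)]

theorem comm_ydot_yop {i r : ℕ} (s v : MM N) (hr : 1 ≤ r ∧ r ≤ n) (hv : pos (-v)) :
    comm (ydot n N pos i s) (yop n N pos r v) =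
      (if s = -v then (if i = r then 1 else 0) else 0 : ℂ) • id := by
  classical
  funext w
  by_cases h : (1 ≤ i ∧ i ≤ n) ∧ pos s
  · rw [ydot_eq_pderiv h, yop_eq_mul ⟨hr, hv⟩, comm_pderiv_mul, MvPolynomial.pderiv_X,
      Pi.single_apply]
    have := yvar_inj h ⟨hr, hv⟩
    simp only [this, eq_comm (a := yvar ⟨hr, hv⟩)]
    split_ifs <;> simp_all
  · rw [ydot_eq_zero h, comm_zero_left (isLinearMap_yop _ _)]
    split_ifs with h1 h2
    · subst h1 h2
      exact absurd ⟨hr, hv⟩ h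
    all_goals simp

theorem isLinearMap_ydiff (i : ℕ) (s : MM N) : IsLinearMap ℂ (ydiff n N pos i s) :=
  isLinearMap_sub (isLinearMap_ydot _ _) (isLinearMap_ydot _ _)

theorem isLinearMap_ydiff₂ (i : ℕ) (s : MM N) : IsLinearMap ℂ (ydiff₂ n N pos i s) :=
  isLinearMap_add (isLinearMap_sub (isLinearMap_ydot _ _)
    (isLinearMap_const_smul _ (isLinearMap_ydot _ _))) (isLinearMap_ydot _ _)

theorem locFin_ydiff (i : ℕ) : LocFin (ydiff n N pos i) := by
  have := locFin_add (locFin_ydot (n := n) (pos := pos) (i - 1))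
    (locFin_smul (fun _ => -1) (locFin_ydot (n := n) (pos := pos) i))
  simp only [neg_smul, one_smul, ← sub_eq_add_neg] at this
  exact this

theorem locFin_ydiff₂ (i : ℕ) : LocFin (ydiff₂ n N pos i) := by
  have := locFin_add (locFin_add (locFin_ydot (n := n) (pos := pos) (i - 1))
    (locFin_smul (fun _ => -2) (locFin_ydot (n := n) (pos := pos) i)))
    (locFin_ydot (n := n) (pos := pos) (i + 1))
  simp only [neg_smul, ← sub_eq_add_neg] at this
  exact this

theorem isLinearMap_dPhi (kappa : MM N → Fin (N + 1) → ℂ) (i : ℕ) (m : MM N) :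
    IsLinearMap ℂ (dPhi n N pos kappa i m) :=
  isLinearMap_add
    (isLinearMap_const_smul _ (isLinearMap_finsum
      (fun _ => isLinearMap_const_smul _ (isLinearMap_ydiff _ _)) (locFin_smul _ (locFin_ydiff i))))
    (isLinearMap_const_smul _ (isLinearMap_finsum
      (fun _ => isLinearMap_const_smul _ (isLinearMap_ydiff₂ _ _))
      (locFin_smul _ (locFin_ydiff₂ i))))

theorem isLinearMap_Phi (kappa : MM N → Fin (N + 1) → ℂ) (lam : ℕ → ℂ) (i : ℕ) (m : MM N) :
    IsLinearMap ℂ (Phi n N pos kappa lam i m) :=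
  isLinearMap_sub (isLinearMap_add (isLinearMap_dPhi _ _ _) (isLinearMap_yop _ _))
    (isLinearMap_const_smul _ LinearMap.id.isLinear)

/-- Commutator with `dPhi`, in terms of commutators with the derivatives. -/
theorem comm_dPhi {A : Fock n N pos → Fock n N pos} (hA : IsLinearMap ℂ A)
    (kappa : MM N → Fin (N + 1) → ℂ) (i : ℕ) (m : MM N) :
    comm A (dPhi n N pos kappa i m) =
      theta pos (-m) • (fun w => ∑ᶠ s, (cnum kappa m s • comm A (ydiff n N pos i s)) w)
    + theta pos m • (fun w => ∑ᶠ s, (cnum kappa m s • comm A (ydiff₂ n N pos i s)) w) := by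
  rw [dPhi, comm_add_right hA, comm_smul_right _ hA, comm_smul_right _ hA,
    comm_finsum hA (locFin_smul _ (locFin_ydiff i)),
    comm_finsum hA (locFin_smul _ (locFin_ydiff₂ i))]
  simp only [comm_smul_right _ hA]

theorem comm_ydiff {A : Fock n N pos → Fock n N pos} (hA : IsLinearMap ℂ A) (i : ℕ) (s : MM N) :
    comm A (ydiff n N pos i s) =
      comm A (ydot n N pos (i - 1) s) - comm A (ydot n N pos i s) :=
  comm_sub_right hA

theorem comm_ydiff₂ {A : Fock n N pos → Fock n N pos} (hA : IsLinearMap ℂ A) (i : ℕ) (s : MM N) :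
    comm A (ydiff₂ n N pos i s) =
      comm A (ydot n N pos (i - 1) s) - (2 : ℂ) • comm A (ydot n N pos i s)
        + comm A (ydot n N pos (i + 1) s) := by
  rw [ydiff₂, comm_add_right hA, comm_sub_right hA, comm_smul_right _ hA]

theorem comm_dPhi_eq_zero {A : Fock n N pos → Fock n N pos} (hA : IsLinearMap ℂ A)
    (h : ∀ i s, comm A (ydot n N pos i s) = 0) (kappa : MM N → Fin (N + 1) → ℂ) (i : ℕ)
    (m : MM N) : comm A (dPhi n N pos kappa i m) = 0 := by
  rw [comm_dPhi hA]
  simp only [comm_ydiff hA, comm_ydiff₂ hA, h]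
  funext w
  simp

theorem comm_const_smul_id {A : Fock n N pos → Fock n N pos} (hA : IsLinearMap ℂ A) (c : ℂ) :
    comm A (c • id) = 0 := by
  funext w
  simp [comm, hA.map_smul]

theorem comm_Phi_eq_zero {A : Fock n N pos → Fock n N pos} (hA : IsLinearMap ℂ A)
    (h : ∀ i s, comm A (ydot n N pos i s) = 0) (h' : ∀ i v, comm A (yop n N pos i v) = 0)
    (kappa : MM N → Fin (N + 1) → ℂ) (lam : ℕ → ℂ) (i : ℕ) (m : MM N) :
    comm A (Phi n N pos kappa lam i m) = 0 := by
  rw [Phi_eq, comm_sub_right hA, comm_add_right hA, comm_dPhi_eq_zero hA h, h',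
    comm_const_smul_id hA, add_zero, sub_zero]

/-- The pairing of a simple root `α_k` with `ε_x`. -/
def rootCoeff (k x : ℕ) : ℂ := (if x = k then 1 else 0) - (if x = k + 1 then 1 else 0)

theorem comm_dPhi_yop (kappa : MM N → Fin (N + 1) → ℂ) {i r : ℕ} (m v : MM N) (hi : 1 ≤ i)
    (hr : 1 ≤ r ∧ r ≤ n) (hv : pos (-v)) :
    comm (dPhi n N pos kappa i m) (yop n N pos r v) =
      (cnum kappa m (-v) *
        (theta pos (-m) * ((if i - 1 = r then 1 else 0) - (if i = r then 1 else 0))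
          - theta pos m * (rootCoeff i r - rootCoeff i (r + 1)))) • id := by
  have hY := isLinearMap_yop (n := n) (pos := pos) r v
  rw [comm_swap, comm_dPhi hY]
  simp only [comm_ydiff hY, comm_ydiff₂ hY, comm_swap (yop n N pos r v), comm_ydot_yop _ v hr hv]
  funext w
  simp only [Pi.neg_apply, Pi.add_apply, Pi.smul_apply, Pi.sub_apply]
  rw [finsum_eq_single _ (-v), finsum_eq_single _ (-v)]
  · simp only [if_true, id]
    have : (if i - 1 = r then 1 else 0 : ℂ) = if r + 1 = i then 1 else 0 :=
      if_congr (by omega) rfl rfl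
    have h2 : (if r + 1 = i + 1 then 1 else 0 : ℂ) = if i = r then 1 else 0 :=
      if_congr (by omega) rfl rfl
    have h3 : (if i + 1 = r then 1 else 0 : ℂ) = if r = i + 1 then 1 else 0 :=
      if_congr (by omega) rfl rfl
    have h4 : (if r = i then 1 else 0 : ℂ) = if i = r then 1 else 0 :=
      if_congr (by omega) rfl rfl
    rw [rootCoeff, rootCoeff, this, h2, h3, h4]
    module
  · intro s hs
    simp [hs]
  · intro s hs
    simp [hs]

/-- The Heisenberg relations for the operators `Φ(b_i(m))`. -/
theorem comm_Phi_Phi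
    (htri : ∀ a : MM N, pos a ∨ a = 0 ∨ pos (-a))
    (hzero : ¬ pos (0 : MM N))
    (hdisj : ∀ a : MM N, pos a → ¬ pos (-a))
    (kappa : MM N → Fin (N + 1) → ℂ) (lam : ℕ → ℂ)
    (hE1 : ∀ m : MM N, ∑ p : Fin (N + 1), (m p : ℂ) * kappa m p = 0)
    (hE2 : ∀ m k : MM N, pos m → pos k →
      ∑ p : Fin (N + 1), (m p : ℂ) * kappa (-m - k) p = 0)
    {k r : ℕ} (hk : 1 ≤ k ∧ k ≤ n) (hr : 1 ≤ r ∧ r ≤ n) (m v : MM N) :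
    comm (Phi n N pos kappa lam k m) (Phi n N pos kappa lam r v) =
      (-(rootCoeff k r - rootCoeff k (r + 1)) * cnum kappa m (-v)) • id := by
  have hdd : comm (dPhi n N pos kappa k m) (dPhi n N pos kappa r v) = 0 := by
    refine comm_dPhi_eq_zero (isLinearMap_dPhi _ _ _) (fun i s => ?_) kappa r v
    rw [comm_swap, comm_dPhi_eq_zero (isLinearMap_ydot _ _) (fun _ _ => comm_ydot_ydot _ _ _ _),
      neg_zero]
  have hsplit : comm (Phi n N pos kappa lam k m) (Phi n N pos kappa lam r v) =
      comm (dPhi n N pos kappa k m) (yop n N pos r v)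
        - comm (dPhi n N pos kappa r v) (yop n N pos k m) := by
    have hL := isLinearMap_add (isLinearMap_dPhi (n := n) (pos := pos) kappa r v)
      (isLinearMap_yop (n := n) (pos := pos) r v)
    rw [Phi_eq kappa lam r, comm_sub_right (isLinearMap_Phi _ _ _ _),
      comm_const_smul_id (isLinearMap_Phi _ _ _ _), sub_zero, Phi_eq, comm_sub_left hL,
      comm_swap (_ • id), comm_const_smul_id hL, neg_zero, sub_zero, comm_swap (_ + _),
      comm_add_right hL, comm_swap _ (yop n N pos k m), comm_swap _ (dPhi n N pos kappa k m),
      comm_add_right (isLinearMap_dPhi _ _ _), comm_add_right (isLinearMap_yop _ _), hdd,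
      comm_yop_yop, comm_swap (yop n N pos k m)]
    abel
  have hsymm : cnum kappa v (-m) = -cnum kappa m (-v) := by
    have := hE1 (-m - v)
    simp only [cnum]
    rw [show -v + -m = -m - v by abel, show -m + -v = -m - v by abel, ← Finset.sum_neg_distrib,
      ← sub_eq_zero, ← neg_zero, ← this, ← Finset.sum_sub_distrib, ← Finset.sum_neg_distrib]
    refine Finset.sum_congr rfl fun p _ => ?_
    simp only [Pi.sub_apply, Pi.neg_apply]
    push_cast
    ring
  have hdd' : rootCoeff r k - rootCoeff r (k + 1) = rootCoeff k r - rootCoeff k (r + 1) := by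
    simp only [rootCoeff]
    split_ifs <;> first | omega | norm_num
  have hpred : (if k - 1 = r then 1 else 0 : ℂ) - (if k = r then 1 else 0)
      + ((if r - 1 = k then 1 else 0) - (if r = k then 1 else 0)) =
        -(rootCoeff k r - rootCoeff k (r + 1)) := by
    simp only [rootCoeff]
    split_ifs <;> first | omega | norm_num
  have hyz : ∀ {a} {u : MM N}, ¬ pos (-u) → yop n N pos a u = 0 := fun h =>
    yop_eq_zero fun h' => h h'.2
  rw [hsplit]
  rcases htri m with hm | rfl | hm
  · rw [hyz (hdisj m hm), comm_zero_right (isLinearMap_dPhi _ _ _), sub_zero]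
    rcases htri v with hv | rfl | hv
    · rw [hyz (hdisj v hv), comm_zero_right (isLinearMap_dPhi _ _ _),
        show cnum kappa m (-v) = 0 from hE2 m v hm hv]
      simp
    · rw [hyz (by simpa using hzero), comm_zero_right (isLinearMap_dPhi _ _ _),
        show cnum kappa m (-0) = 0 from ?_]
      · simp
      · have := hE1 (-m)
        simpa [cnum] using this
    · rw [comm_dPhi_yop kappa m v hk.1 hr hv]
      congr 1
      simp only [theta, hm, hdisj m hm, if_true, if_false]
      ring
  · rw [hyz (a := k) (by simpa using hzero), comm_zero_right (isLinearMap_dPhi _ _ _), sub_zero,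
      show cnum kappa 0 (-v) = 0 from by simp [cnum]]
    by_cases hv : pos (-v)
    · rw [comm_dPhi_yop kappa 0 v hk.1 hr hv]
      simp [cnum]
    · rw [hyz hv, comm_zero_right (isLinearMap_dPhi _ _ _)]
      simp
  · have hm' : ¬ pos m := fun h => hdisj m h hm
    rw [comm_dPhi_yop kappa v m hr.1 hk hm, hsymm]
    rcases htri v with hv | rfl | hv
    · rw [hyz (hdisj v hv), comm_zero_right (isLinearMap_dPhi _ _ _), zero_sub, ← neg_smul]
      congr 1
      simp only [theta, hv, hdisj v hv, if_true, if_false, hdd']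
      ring
    · rw [hyz (by simpa using hzero), comm_zero_right (isLinearMap_dPhi _ _ _), zero_sub,
        show cnum kappa m (-0) = 0 from ?_]
      · simp
      · have := hE1 (-m)
        simpa [cnum] using this
    · have hv' : ¬ pos v := fun h => hdisj v h hv
      rw [comm_dPhi_yop kappa m v hk.1 hr hv, ← sub_smul, ← hpred]
      congr 1
      simp only [theta, hv, hm, hv', hm', if_true, if_false]
      ring

end Heisenberg

section Weights

variable {n N : ℕ} {pos : MM N → Prop}

/-- A family of linear operators commuting with all derivatives `∂/∂x_{ij}(m)`. -/
structure XConstant (Y : MM N → Fock n N pos → Fock n N pos) : Prop where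
  linear : ∀ m, IsLinearMap ℂ (Y m)
  comm_astar : ∀ i j v m, comm (astar n N pos i j v) (Y m) = 0

theorem XConstant.astar (i j : ℕ) : XConstant (astar n N pos i j) :=
  ⟨isLinearMap_astar i j, fun _ _ _ _ => comm_astar_astar _ _ _ _ _ _⟩

theorem XConstant.phi (kappa : MM N → Fin (N + 1) → ℂ) (lam : ℕ → ℂ) (r : ℕ) :
    XConstant (Phi n N pos kappa lam r) :=
  ⟨isLinearMap_Phi _ _ _, fun _ _ _ _ => comm_Phi_eq_zero (isLinearMap_astar _ _ _)
    (fun _ _ => comm_astar_ydot _ _ _ _ _) (fun _ _ => comm_astar_yop _ _ _ _ _) _ _ _ _⟩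

theorem kD_eq (kappa : MM N → Fin (N + 1) → ℂ) (i j : ℕ) (v : MM N) :
    kD n N pos kappa i j v = fun w => ∑ᶠ q : MM N,
      ((∑ p : Fin (N + 1), kappa (q - v) p * (-(q p : ℂ))) • astar n N pos i j q) w := rfl

theorem XConstant.kD (kappa : MM N → Fin (N + 1) → ℂ) (i j : ℕ) :
    XConstant (kD n N pos kappa i j) where
  linear _ := isLinearMap_finsum (fun _ => isLinearMap_const_smul _ (isLinearMap_astar _ _ _))
    (locFin_smul _ (locFin_astar i j))
  comm_astar _ _ _ _ := comm_finsum_eq_zero (isLinearMap_astar _ _ _)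
    (locFin_smul _ (locFin_astar i j)) fun _ =>
      (comm_smul_right _ (isLinearMap_astar _ _ _)).trans (by rw [comm_astar_astar, smul_zero])

theorem XConstant.prodFinite {Y : MM N → Fock n N pos → Fock n N pos} (hY : XConstant Y)
    (i j : ℕ) : ProdFinite (Stmt13.astar n N pos i j) Y :=
  prodFinite_of_comm hY.linear (locFin_astar i j) fun _ _ => hY.comm_astar _ _ _ _

theorem XConstant.fmul {Y : MM N → Fock n N pos → Fock n N pos} (hY : XConstant Y) (i j : ℕ) :
    XConstant (fmul n N pos (Stmt13.astar n N pos i j) Y) where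
  linear := isLinearMap_fmul (isLinearMap_astar i j) hY.linear (hY.prodFinite i j)
  comm_astar _ _ _ := comm_fmul_eq_zero (isLinearMap_astar _ _ _) (isLinearMap_astar i j)
    (hY.prodFinite i j) (fun _ => comm_astar_astar _ _ _ _ _ _) fun _ => hY.comm_astar _ _ _ _

theorem XConstant.zero : XConstant (0 : MM N → Fock n N pos → Fock n N pos) :=
  ⟨fun _ => isLinearMap_zero, fun _ _ _ _ => comm_zero_right (isLinearMap_astar _ _ _)⟩

theorem XConstant.add {Y Y' : MM N → Fock n N pos → Fock n N pos} (hY : XConstant Y)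
    (hY' : XConstant Y') : XConstant (Y + Y') :=
  ⟨fun m => isLinearMap_add (hY.linear m) (hY'.linear m), fun i j v m => by
    rw [Pi.add_apply, comm_add_right (isLinearMap_astar _ _ _), hY.comm_astar, hY'.comm_astar,
      add_zero]⟩

theorem XConstant.sum {ι : Type*} {s : Finset ι} {Y : ι → MM N → Fock n N pos → Fock n N pos}
    (hY : ∀ i ∈ s, XConstant (Y i)) : XConstant (∑ i ∈ s, Y i) :=
  Finset.sum_induction Y XConstant (fun _ _ => XConstant.add) XConstant.zero hY

theorem locFin_fmul {X Y : MM N → Fock n N pos → Fock n N pos}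
    (hX : ∀ k, IsLinearMap ℂ (X k)) (hX' : LocFin X) (hY : LocFin Y) :
    LocFin (fmul n N pos X Y) := fun w => by
  refine ((hY w).biUnion fun l _ => (hX' (Y l w)).image (· + l)).subset fun v hv => ?_
  obtain ⟨k, hk⟩ : ∃ k, X k (Y (v - k) w) ≠ 0 := by
    contrapose! hv
    exact Set.notMem_compl_iff.2 (finsum_eq_zero_of_forall_eq_zero hv)
  refine Set.mem_biUnion (x := v - k) (fun h => hk ?_) ⟨k, hk, add_sub_cancel _ _⟩
  simp only [h, (hX k).map_zero]

/-- The number operators `(a_{pq} a^*_{pq})_m`. -/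
def numOp (n N : ℕ) (pos : MM N → Prop) (p q : ℕ) (m : MM N) : Fock n N pos → Fock n N pos :=
  fmul n N pos (aop n N pos p q) (astar n N pos p q) m

theorem prodFinite_aop_astar (p q : ℕ) : ProdFinite (aop n N pos p q) (astar n N pos p q) :=
  prodFinite_of_locFin_right (isLinearMap_aop p q) (locFin_astar p q)

theorem isLinearMap_numOp (p q : ℕ) (m : MM N) : IsLinearMap ℂ (numOp n N pos p q m) :=
  isLinearMap_fmul (isLinearMap_aop p q) (isLinearMap_astar p q) (prodFinite_aop_astar p q) m

theorem comm_numOp_eq_zero {A : Fock n N pos → Fock n N pos} (hA : IsLinearMap ℂ A)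
    (h : ∀ i j v, comm (aop n N pos i j v) A = 0) (h' : ∀ i j v, comm (astar n N pos i j v) A = 0)
    (p q : ℕ) (m : MM N) : comm (numOp n N pos p q m) A = 0 := by
  rw [comm_swap, numOp, comm_fmul_eq_zero hA (isLinearMap_aop p q) (prodFinite_aop_astar p q),
    neg_zero]
  · intro k
    rw [comm_swap, h, neg_zero]
  · intro k
    rw [comm_swap, h', neg_zero]

theorem comm_numOp_astar (p q i j : ℕ) (m v : MM N) :
    comm (numOp n N pos p q m) (astar n N pos i j v) =
      (if p = i ∧ q = j then 1 else 0 : ℂ) • astar n N pos i j (v + m) := by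
  rw [comm_swap, numOp, comm_fmul (isLinearMap_astar _ _ _) (isLinearMap_aop p q)
    (prodFinite_aop_astar p q)]
  funext w
  simp only [comm_astar_astar, comm_astar_aop, Pi.zero_apply, (isLinearMap_aop _ _ _).map_zero,
    add_zero, Pi.neg_apply, Pi.smul_apply]
  rw [finsum_eq_single _ (-v) fun k hk => if_neg fun h => hk h.2.2]
  split_ifs with h1 h2 h2
  · obtain ⟨rfl, rfl⟩ := h2
    simp [add_comm v]
  · exact absurd h1.2.1 h2
  · have : ¬ (1 ≤ i ∧ i < j ∧ j ≤ n + 1) := fun h => h1 ⟨h, h2, rfl⟩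
    simp [astar_eq_zero this]
  · simp

theorem comm_numOp_aop (p q i j : ℕ) (m v : MM N) :
    comm (numOp n N pos p q m) (aop n N pos i j v) =
      (if p = i ∧ q = j then 1 else 0 : ℂ) • -aop n N pos i j (v + m) := by
  rw [comm_swap, numOp, comm_fmul (isLinearMap_aop _ _ _) (isLinearMap_aop p q)
    (prodFinite_aop_astar p q)]
  funext w
  simp only [comm_aop_aop, comm_swap (aop n N pos i j v) (astar _ _ _ _ _ _), comm_astar_aop,
    Pi.zero_apply, zero_add, Pi.neg_apply, Pi.smul_apply]
  rw [finsum_eq_single _ (v + m) fun k hk => by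
    rw [if_neg fun h => hk (by rw [h.2.2]; abel), neg_zero, (isLinearMap_aop _ _ _).map_zero]]
  have hv : v = -(m - (v + m)) := by abel
  split_ifs with h1 h2 h2
  · obtain ⟨rfl, rfl⟩ := h2
    simp
  · exact absurd ⟨h1.2.1.1.symm, h1.2.1.2.symm⟩ h2
  · obtain ⟨rfl, rfl⟩ := h2
    have : ¬ (1 ≤ p ∧ p < q ∧ q ≤ n + 1) := fun h => h1 ⟨h, ⟨rfl, rfl⟩, hv⟩
    simp [aop_eq_zero this]
  · simp [(isLinearMap_aop _ _ _).map_zero]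

/-- The part of `ρ(H_k)_m` quadratic in the `a`, `a^*`. -/
def numH (n N : ℕ) (pos : MM N → Prop) (k : ℕ) (m : MM N) : Fock n N pos → Fock n N pos :=
  (2 : ℂ) • numOp n N pos k (k + 1) m
  + ∑ i ∈ Finset.Ico 1 k, (numOp n N pos i (k + 1) m - numOp n N pos i k m)
  + ∑ j ∈ Finset.Icc (k + 2) (n + 1), (numOp n N pos k j m - numOp n N pos (k + 1) j m)

theorem rhoHn_eq (kappa : MM N → Fin (N + 1) → ℂ) (lam : ℕ → ℂ) (k : ℕ) (m : MM N) :
    rhoHn n N pos kappa lam k m = numH n N pos k m + Phi n N pos kappa lam k m := rfl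

theorem isLinearMap_numH (k : ℕ) (m : MM N) : IsLinearMap ℂ (numH n N pos k m) :=
  isLinearMap_add (isLinearMap_add (isLinearMap_const_smul _ (isLinearMap_numOp _ _ _))
    (isLinearMap_sum fun _ => isLinearMap_sub (isLinearMap_numOp _ _ _) (isLinearMap_numOp _ _ _)))
    (isLinearMap_sum fun _ => isLinearMap_sub (isLinearMap_numOp _ _ _) (isLinearMap_numOp _ _ _))

theorem isLinearMap_rhoHn (kappa : MM N → Fin (N + 1) → ℂ) (lam : ℕ → ℂ) (k : ℕ) (m : MM N) :
    IsLinearMap ℂ (rhoHn n N pos kappa lam k m) :=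
  isLinearMap_add (isLinearMap_numH _ _) (isLinearMap_Phi _ _ _ _)

theorem comm_numH {g : Fock n N pos → Fock n N pos} (hg : IsLinearMap ℂ g) (k : ℕ) (m : MM N) :
    comm (numH n N pos k m) g =
      (2 : ℂ) • comm (numOp n N pos k (k + 1) m) g
      + ∑ i ∈ Finset.Ico 1 k, (comm (numOp n N pos i (k + 1) m) g - comm (numOp n N pos i k m) g)
      + ∑ j ∈ Finset.Icc (k + 2) (n + 1),
        (comm (numOp n N pos k j m) g - comm (numOp n N pos (k + 1) j m) g) := by
  rw [numH, comm_add_left hg, comm_add_left hg, comm_smul_left _ hg, comm_sum_left hg,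
    comm_sum_left hg]
  simp only [comm_sub_left hg]

theorem rootCoeff_sub_eq_sum {k i j : ℕ} (h : 1 ≤ i ∧ i < j ∧ j ≤ n + 1) :
    (2 : ℂ) * (if k = i ∧ k + 1 = j then 1 else 0)
      + ∑ a ∈ Finset.Ico 1 k,
        ((if a = i ∧ k + 1 = j then 1 else 0) - (if a = i ∧ k = j then 1 else 0))
      + ∑ b ∈ Finset.Icc (k + 2) (n + 1),
        ((if k = i ∧ b = j then 1 else 0) - (if k + 1 = i ∧ b = j then 1 else 0))
      = rootCoeff k i - rootCoeff k j := by
  have h1 : ∀ P : Prop, [Decidable P] → ∑ a ∈ Finset.Ico 1 k, (if a = i ∧ P then 1 else 0 : ℂ) =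
      if i < k ∧ P then 1 else 0 := fun P _ => by
    by_cases hP : P <;> simp [hP, h.1]
  have h2 : ∀ P : Prop, [Decidable P] →
      ∑ b ∈ Finset.Icc (k + 2) (n + 1), (if P ∧ b = j then 1 else 0 : ℂ) =
      if P ∧ k + 2 ≤ j then 1 else 0 := fun P _ => by
    by_cases hP : P <;> simp [hP, h.2.2]
  rw [Finset.sum_sub_distrib, Finset.sum_sub_distrib, h1, h1, h2, h2, rootCoeff, rootCoeff]
  split_ifs <;> first | omega | norm_num

theorem comm_numH_of_weight {g h : Fock n N pos → Fock n N pos} (hg : IsLinearMap ℂ g)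
    {k i j : ℕ} {m : MM N} (hij : 1 ≤ i ∧ i < j ∧ j ≤ n + 1)
    (hgh : ∀ p q, comm (numOp n N pos p q m) g = (if p = i ∧ q = j then 1 else 0 : ℂ) • h) :
    comm (numH n N pos k m) g = (rootCoeff k i - rootCoeff k j) • h := by
  rw [comm_numH hg, ← rootCoeff_sub_eq_sum hij]
  simp only [hgh, add_smul, Finset.sum_smul, sub_smul, mul_smul]

theorem comm_rhoHn_astar (kappa : MM N → Fin (N + 1) → ℂ) (lam : ℕ → ℂ) (k i j : ℕ) (m v : MM N) :
    comm (rhoHn n N pos kappa lam k m) (astar n N pos i j v) =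
      (rootCoeff k i - rootCoeff k j) • astar n N pos i j (v + m) := by
  by_cases h : 1 ≤ i ∧ i < j ∧ j ≤ n + 1
  · rw [rhoHn_eq, comm_add_left (isLinearMap_astar _ _ _), comm_swap (Phi _ _ _ _ _ _ _),
      (XConstant.phi kappa lam k).comm_astar, neg_zero, add_zero]
    exact comm_numH_of_weight (isLinearMap_astar _ _ _) h fun p q => comm_numOp_astar _ _ _ _ _ _
  · rw [astar_eq_zero h, astar_eq_zero h, comm_zero_right (isLinearMap_rhoHn _ _ _ _), smul_zero]

theorem comm_rhoHn_aop (kappa : MM N → Fin (N + 1) → ℂ) (lam : ℕ → ℂ) (k i j : ℕ) (m v : MM N) :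
    comm (rhoHn n N pos kappa lam k m) (aop n N pos i j v) =
      (-(rootCoeff k i - rootCoeff k j)) • aop n N pos i j (v + m) := by
  by_cases h : 1 ≤ i ∧ i < j ∧ j ≤ n + 1
  · rw [rhoHn_eq, comm_add_left (isLinearMap_aop _ _ _), comm_swap (Phi _ _ _ _ _ _ _),
      comm_Phi_eq_zero (isLinearMap_aop _ _ _) (fun _ _ => comm_aop_ydot _ _ _ _ _)
        (fun _ _ => comm_aop_yop _ _ _ _ _), neg_zero, add_zero,
      comm_numH_of_weight (isLinearMap_aop _ _ _) h fun p q => comm_numOp_aop _ _ _ _ _ _,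
      smul_neg, neg_smul]
  · rw [aop_eq_zero h, aop_eq_zero h, comm_zero_right (isLinearMap_rhoHn _ _ _ _), smul_zero]

theorem comm_numH_Phi (kappa : MM N → Fin (N + 1) → ℂ) (lam : ℕ → ℂ) (k r : ℕ) (m v : MM N) :
    comm (numH n N pos k m) (Phi n N pos kappa lam r v) = 0 := by
  rw [comm_numH (isLinearMap_Phi _ _ _ _)]
  have := comm_numOp_eq_zero (isLinearMap_Phi (n := n) (pos := pos) kappa lam r v)
    (fun i j m => comm_Phi_eq_zero (isLinearMap_aop _ _ _) (fun _ _ => comm_aop_ydot _ _ _ _ _)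
        (fun _ _ => comm_aop_yop _ _ _ _ _) _ _ _ _)
    (fun i j m => (XConstant.phi kappa lam r).comm_astar _ _ _ _)
  simp [this]

end Weights

section RaisingFactor

variable {n N : ℕ} {pos : MM N → Prop}

/-- The family of scalar operators proportional to the commutators `[Φ(b_k(m)), Φ(b_r(u))]`. -/
def cfam (n N : ℕ) (pos : MM N → Prop) (kappa : MM N → Fin (N + 1) → ℂ) (m : MM N) :
    MM N → Fock n N pos → Fock n N pos := fun u => cnum kappa m (-u) • id

theorem comm_rhoHn_kD (kappa : MM N → Fin (N + 1) → ℂ) (lam : ℕ → ℂ) (k i j : ℕ) (m v : MM N) :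
    comm (rhoHn n N pos kappa lam k m) (kD n N pos kappa i j v) =
      (rootCoeff k i - rootCoeff k j) •
        (kD n N pos kappa i j (v + m)
          + fmul n N pos (astar n N pos i j) (cfam n N pos kappa m) v) := by
  have hL := locFin_astar (n := n) (pos := pos) i j
  rw [kD_eq, comm_finsum (isLinearMap_rhoHn _ _ _ _) (locFin_smul _ hL)]
  funext w
  have h1 := locFin_smul (fun q => ∑ p, kappa (q - (v + m)) p * (-(q p : ℂ))) hL w
  have h2 := locFin_smul (fun q => cnum kappa m (q - v)) hL w
  simp only [comm_smul_right _ (isLinearMap_rhoHn kappa lam k m), comm_rhoHn_astar, Pi.smul_apply,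
    Pi.add_apply, kD, fmul, cfam, (isLinearMap_astar _ _ _).map_smul, id]
  simp only [neg_sub]
  simp only [Pi.smul_apply] at h1 h2
  rw [← finsum_add_distrib h1 h2, smul_finsum,
    ← finsum_comp_equiv (Equiv.addRight m) (f := fun q => (rootCoeff k i - rootCoeff k j) • _)]
  refine finsum_congr fun q => ?_
  simp only [Equiv.coe_addRight, ← add_smul]
  rw [smul_comm]
  congr 2
  rw [cnum, ← Finset.sum_add_distrib]
  refine Finset.sum_congr rfl fun p _ => ?_
  rw [show q + m - (v + m) = q - v by abel, show -m + (q + m - v) = q - v by abel]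
  simp only [Pi.add_apply]
  push_cast
  ring

/-- The factor of `ρ(F_0)` attached to sequences ending in `j`. -/
def endFactor (n N : ℕ) (pos : MM N → Prop) (kappa : MM N → Fin (N + 1) → ℂ) (lam : ℕ → ℂ)
    (j : ℕ) : MM N → Fock n N pos → Fock n N pos :=
  ∑ r ∈ Finset.Icc j n, fmul n N pos (astar n N pos j (n + 1)) (Phi n N pos kappa lam r)
    + kD n N pos kappa j (n + 1)

theorem XConstant.endFactor (kappa : MM N → Fin (N + 1) → ℂ) (lam : ℕ → ℂ) (j : ℕ) :
    XConstant (endFactor n N pos kappa lam j) :=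
  (XConstant.sum fun r _ => (XConstant.phi kappa lam r).fmul j (n + 1)).add
    (XConstant.kD kappa j (n + 1))

theorem comm_rhoHn_endFactor
    (htri : ∀ a : MM N, pos a ∨ a = 0 ∨ pos (-a))
    (hzero : ¬ pos (0 : MM N))
    (hdisj : ∀ a : MM N, pos a → ¬ pos (-a))
    (kappa : MM N → Fin (N + 1) → ℂ) (lam : ℕ → ℂ)
    (hE1 : ∀ m : MM N, ∑ p : Fin (N + 1), (m p : ℂ) * kappa m p = 0)
    (hE2 : ∀ m k : MM N, pos m → pos k →
      ∑ p : Fin (N + 1), (m p : ℂ) * kappa (-m - k) p = 0)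
    {k j : ℕ} (hk : 1 ≤ k ∧ k ≤ n) (hj : 1 ≤ j ∧ j ≤ n + 1) (m v : MM N) :
    comm (rhoHn n N pos kappa lam k m) (endFactor n N pos kappa lam j v) =
      (rootCoeff k j - rootCoeff k (n + 1)) • endFactor n N pos kappa lam j (v + m) := by
  have hH := isLinearMap_rhoHn (n := n) (pos := pos) kappa lam k m
  have htel : ∑ r ∈ Finset.Icc j n, -(rootCoeff k r - rootCoeff k (r + 1)) =
      -(rootCoeff k j - rootCoeff k (n + 1)) := by
    rw [← Finset.Ico_add_one_right_eq_Icc]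
    simp only [neg_sub]
    exact Finset.sum_Ico_sub _ hj.2
  have hPhi : ∀ r ∈ Finset.Icc j n,
      comm (rhoHn n N pos kappa lam k m)
        (fmul n N pos (astar n N pos j (n + 1)) (Phi n N pos kappa lam r) v) =
      (rootCoeff k j - rootCoeff k (n + 1)) •
        fmul n N pos (astar n N pos j (n + 1)) (Phi n N pos kappa lam r) (v + m)
      + (-(rootCoeff k r - rootCoeff k (r + 1))) •
        fmul n N pos (astar n N pos j (n + 1)) (cfam n N pos kappa m) v := fun r hr => by
    rw [Finset.mem_Icc] at hr
    have hc : (fun u => comm (rhoHn n N pos kappa lam k m) (Phi n N pos kappa lam r u)) =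
        (-(rootCoeff k r - rootCoeff k (r + 1))) • cfam n N pos kappa m := funext fun u => by
      rw [rhoHn_eq, comm_add_left (isLinearMap_Phi _ _ _ _), comm_numH_Phi, zero_add,
        comm_Phi_Phi htri hzero hdisj kappa lam hE1 hE2 hk ⟨hj.1.trans hr.1, hr.2⟩]
      simp only [Pi.smul_apply, cfam, mul_smul]
    rw [comm_fmul_of_weight hH (isLinearMap_astar _ _)
      ((XConstant.phi kappa lam r).prodFinite _ _) (fun _ => comm_rhoHn_astar _ _ _ _ _ _ _), hc,
      fmul_smul_right (isLinearMap_astar _ _) (-(rootCoeff k r - rootCoeff k (r + 1)))]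
  simp only [endFactor, Pi.add_apply, Finset.sum_apply]
  rw [comm_add_right hH, comm_sum_right hH, Finset.sum_congr rfl hPhi, Finset.sum_add_distrib,
    ← Finset.smul_sum, ← Finset.sum_smul, htel, comm_rhoHn_kD]
  module

end RaisingFactor

section Lists

/-- The weights of the steps of a path telescope. -/
theorem sum_map_qpairs (f : ℕ → ℂ) (a : ℕ) (t : List ℕ) :
    ((qpairs (a :: t)).map fun p => f p.1 - f p.2).sum =
      f a - f ((a :: t).getLast?.getD 0) := by
  induction t generalizing a with
  | nil => simp [qpairs]
  | cons b t ih =>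
    have : qpairs (a :: b :: t) = (a, b) :: qpairs (b :: t) := rfl
    rw [this, List.map_cons, List.sum_cons, ih, List.getLast?_cons_cons]
    ring

theorem qpairs_append_singleton (a x : ℕ) (t : List ℕ) :
    qpairs (a :: t ++ [x]) = qpairs (a :: t) ++ [((a :: t).getLast?.getD 0, x)] := by
  induction t generalizing a with
  | nil => simp [qpairs]
  | cons b t ih =>
    have h : ∀ u : List ℕ, qpairs (a :: b :: u) = (a, b) :: qpairs (b :: u) := fun _ => rfl
    rw [List.cons_append, List.cons_append, h, h, List.getLast?_cons_cons, List.cons_append, ← ih,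
      List.cons_append]

theorem qend_mem_Icc {n : ℕ} {s : Finset ℕ} (hs : s ∈ (Finset.Icc 2 (n + 1)).powerset) :
    1 ≤ qend s ∧ qend s ≤ n + 1 := by
  have h : qend s ∈ ql s := by
    rw [qend, ql, List.getLast?_eq_getLast_of_ne_nil (List.cons_ne_nil _ _)]
    exact List.getLast_mem _
  rw [ql, List.mem_cons, Finset.mem_sort] at h
  rcases h with h | h
  · omega
  · have := Finset.mem_Icc.1 (Finset.mem_powerset.1 hs h)
    omega

end Lists

section Chains

variable {n N : ℕ} {pos : MM N → Prop}

/-- The product `a^*_{p_1} ⋯ a^*_{p_l} Y` along a list of index pairs. -/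
def chain (n N : ℕ) (pos : MM N → Prop) (L : List (ℕ × ℕ))
    (Y : MM N → Fock n N pos → Fock n N pos) : MM N → Fock n N pos → Fock n N pos :=
  L.foldr (fun p Y => fmul n N pos (astar n N pos p.1 p.2) Y) Y

theorem chain_cons (p : ℕ × ℕ) (L : List (ℕ × ℕ)) (Y : MM N → Fock n N pos → Fock n N pos) :
    chain n N pos (p :: L) Y = fmul n N pos (astar n N pos p.1 p.2) (chain n N pos L Y) := rfl

theorem chain_append_singleton (L : List (ℕ × ℕ)) (p : ℕ × ℕ)
    (Y : MM N → Fock n N pos → Fock n N pos) :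
    chain n N pos (L ++ [p]) Y = chain n N pos L (fmul n N pos (astar n N pos p.1 p.2) Y) :=
  List.foldr_append

theorem fprod_map_append (L : List (ℕ × ℕ)) {Y : MM N → Fock n N pos → Fock n N pos}
    (hY : ∀ v, IsLinearMap ℂ (Y v)) :
    fprod n N pos ((L.map fun p => astar n N pos p.1 p.2) ++ [Y]) = chain n N pos L Y := by
  induction L with
  | nil =>
    funext m w
    simp only [List.map_nil, List.nil_append, fprod, fmul, chain, List.foldr_nil]
    rw [finsum_eq_single _ m fun k hk => by
      rw [if_neg (sub_ne_zero.2 hk.symm), (hY k).map_zero]]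
    simp
  | cons p L ih =>
    rw [List.map_cons, List.cons_append, fprod, ih, chain_cons]

theorem XConstant.chain {Y : MM N → Fock n N pos → Fock n N pos} (hY : XConstant Y)
    (L : List (ℕ × ℕ)) : XConstant (chain n N pos L Y) := by
  induction L with
  | nil => exact hY
  | cons p L ih => exact ih.fmul _ _

theorem locFin_chain {Y : MM N → Fock n N pos → Fock n N pos} (hY : LocFin Y)
    (L : List (ℕ × ℕ)) : LocFin (chain n N pos L Y) := by
  induction L with
  | nil => exact hY
  | cons p L ih => exact locFin_fmul (isLinearMap_astar _ _) (locFin_astar _ _) ih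

theorem chain_zero (L : List (ℕ × ℕ)) : chain n N pos L 0 = 0 := by
  induction L with
  | nil => rfl
  | cons p L ih => rw [chain_cons, ih, fmul_zero_right (isLinearMap_astar _ _)]

theorem chain_add {Y Y' : MM N → Fock n N pos → Fock n N pos} (hY : XConstant Y)
    (hY' : XConstant Y') (L : List (ℕ × ℕ)) :
    chain n N pos L (Y + Y') = chain n N pos L Y + chain n N pos L Y' := by
  induction L with
  | nil => rfl
  | cons p L ih =>
    rw [chain_cons, ih, fmul_add_right (isLinearMap_astar _ _) ((hY.chain L).prodFinite _ _)
      ((hY'.chain L).prodFinite _ _)]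
    rfl

theorem chain_sum {ι : Type*} {s : Finset ι} {Y : ι → MM N → Fock n N pos → Fock n N pos}
    (hY : ∀ i, XConstant (Y i)) (L : List (ℕ × ℕ)) :
    chain n N pos L (∑ i ∈ s, Y i) = ∑ i ∈ s, chain n N pos L (Y i) := by
  classical
  induction s using Finset.induction_on with
  | empty => simp [chain_zero]
  | insert a s ha ih =>
    rw [Finset.sum_insert ha, Finset.sum_insert ha,
      chain_add (hY a) (XConstant.sum fun i _ => hY i), ih]

theorem comm_rhoHn_chain {kappa : MM N → Fin (N + 1) → ℂ} {lam : ℕ → ℂ} {k : ℕ} {m : MM N}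
    {Y : MM N → Fock n N pos → Fock n N pos} (hY : XConstant Y) {c : ℂ}
    (h : ∀ v, comm (rhoHn n N pos kappa lam k m) (Y v) = c • Y (v + m)) (L : List (ℕ × ℕ))
    (v : MM N) :
    comm (rhoHn n N pos kappa lam k m) (chain n N pos L Y v) =
      ((L.map fun p => rootCoeff k p.1 - rootCoeff k p.2).sum + c) •
        chain n N pos L Y (v + m) := by
  induction L generalizing v with
  | nil => simpa [chain] using h v
  | cons p L ih =>
    rw [chain_cons, comm_fmul_of_weights (isLinearMap_rhoHn _ _ _ _) (isLinearMap_astar _ _)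
      ((hY.chain L).prodFinite _ _) (fun _ => comm_rhoHn_astar _ _ _ _ _ _ _) ih, List.map_cons,
      List.sum_cons, add_assoc]

end Chains

section LoweringZero

variable {n N : ℕ} {pos : MM N → Prop}

/-- The summand of `ρ(F_0)` containing `a_{r,j}`, for the path encoded by `s` and ending in `j`. -/
def pathTerm (n N : ℕ) (pos : MM N → Prop) (r : ℕ) (s : Finset ℕ) :
    MM N → Fock n N pos → Fock n N pos :=
  fmul n N pos (aop n N pos r (qend s)) (chain n N pos (qpairs (ql s)) (astar n N pos r (n + 1)))

theorem prodFinite_pathTerm (r : ℕ) (s : Finset ℕ) :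
    ProdFinite (aop n N pos r (qend s))
      (chain n N pos (qpairs (ql s)) (astar n N pos r (n + 1))) :=
  prodFinite_of_locFin_right (isLinearMap_aop _ _) (locFin_chain (locFin_astar _ _) _)

theorem isLinearMap_pathTerm (r : ℕ) (s : Finset ℕ) (v : MM N) :
    IsLinearMap ℂ (pathTerm n N pos r s v) :=
  isLinearMap_fmul (isLinearMap_aop _ _) ((XConstant.astar _ _).chain _).linear
    (prodFinite_pathTerm r s) v

theorem sum_map_qpairs_ql (f : ℕ → ℂ) (s : Finset ℕ) :
    ((qpairs (ql s)).map fun p => f p.1 - f p.2).sum = f 1 - f (qend s) :=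
  sum_map_qpairs f 1 _

theorem comm_rhoHn_pathTerm (kappa : MM N → Fin (N + 1) → ℂ) (lam : ℕ → ℂ) (k r : ℕ)
    (s : Finset ℕ) (m v : MM N) :
    comm (rhoHn n N pos kappa lam k m) (pathTerm n N pos r s v) =
      (rootCoeff k 1 - rootCoeff k (n + 1)) • pathTerm n N pos r s (v + m) := by
  rw [pathTerm, comm_fmul_of_weights (isLinearMap_rhoHn _ _ _ _) (isLinearMap_aop _ _)
    (prodFinite_pathTerm r s) (fun _ => comm_rhoHn_aop _ _ _ _ _ _ _)
    (comm_rhoHn_chain (XConstant.astar _ _) (fun _ => comm_rhoHn_astar _ _ _ _ _ _ _) _),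
    sum_map_qpairs_ql]
  congr 1
  ring

theorem rhoF0_eq (kappa : MM N → Fin (N + 1) → ℂ) (lam : ℕ → ℂ) (v : MM N) :
    rhoF0 n N pos kappa lam v =
      -(∑ r ∈ Finset.Icc 1 (n + 1), ∑ j ∈ Finset.Icc 1 (n + 1),
          ∑ s ∈ (Finset.Icc 2 (n + 1)).powerset,
            if r < j ∧ qend s = j ∧ qpen s ≤ r then pathTerm n N pos r s v else 0)
        - ∑ s ∈ (Finset.Icc 2 (n + 1)).powerset,
            chain n N pos (qpairs (ql s)) (endFactor n N pos kappa lam (qend s)) v := by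
  rw [rhoF0, sub_sub]
  refine congrArg₂ (fun a b => -a - b) ?_ ?_
  · refine Finset.sum_congr rfl fun r _ => Finset.sum_congr rfl fun j _ =>
      Finset.sum_congr rfl fun s _ => if_ctx_congr Iff.rfl (fun h => ?_) fun _ => rfl
    rw [pathTerm, ← fprod_map_append _ (isLinearMap_astar _ _), h.2.1]
    rfl
  · rw [Finset.sum_comm, Finset.sum_comm (s := Finset.Icc 1 n) (t := Finset.powerset _),
      ← Finset.sum_add_distrib]
    refine Finset.sum_congr rfl fun s hs => ?_
    have hq := qend_mem_Icc hs
    have hPhi := fun r => (XConstant.phi (n := n) (pos := pos) kappa lam r).fmul (qend s) (n + 1)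
    rw [endFactor, chain_add (XConstant.sum fun r _ => hPhi r) (XConstant.kD _ _ _),
      chain_sum hPhi, Pi.add_apply, Finset.sum_apply, ← Finset.sum_filter]
    congr 1
    · refine Finset.sum_congr (by ext; simp; omega) fun r _ => ?_
      rw [fprod_map_append _ (isLinearMap_Phi _ _ _), ql, qpairs_append_singleton,
        chain_append_singleton]
      rfl
    · rw [Finset.sum_ite_eq]
      split_ifs with h
      · rw [fprod_map_append _ (XConstant.kD _ _ _).linear]
      · have h0 : kD n N pos kappa (qend s) (n + 1) = 0 := by
          funext v w
          rw [Finset.mem_Icc] at h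
          simp [kD, astar_eq_zero (show ¬ (1 ≤ qend s ∧ qend s < n + 1 ∧ n + 1 ≤ n + 1) by omega)]
        rw [h0, chain_zero, Pi.zero_apply]

theorem isLinearMap_rhoF0 (kappa : MM N → Fin (N + 1) → ℂ) (lam : ℕ → ℂ) (v : MM N) :
    IsLinearMap ℂ (rhoF0 n N pos kappa lam v) := by
  rw [rhoF0_eq, ← neg_one_smul ℂ]
  refine isLinearMap_sub (isLinearMap_const_smul _ (isLinearMap_sum fun r => isLinearMap_sum fun j =>
    isLinearMap_sum fun s => ?_)) (isLinearMap_sum fun s => ((XConstant.endFactor _ _ _).chain _).linear v)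
  split_ifs
  · exact isLinearMap_pathTerm _ _ _
  · exact isLinearMap_zero

theorem comm_rhoHn_rhoF0
    (htri : ∀ a : MM N, pos a ∨ a = 0 ∨ pos (-a))
    (hzero : ¬ pos (0 : MM N))
    (hdisj : ∀ a : MM N, pos a → ¬ pos (-a))
    (kappa : MM N → Fin (N + 1) → ℂ) (lam : ℕ → ℂ)
    (hE1 : ∀ m : MM N, ∑ p : Fin (N + 1), (m p : ℂ) * kappa m p = 0)
    (hE2 : ∀ m k : MM N, pos m → pos k →
      ∑ p : Fin (N + 1), (m p : ℂ) * kappa (-m - k) p = 0)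
    {k : ℕ} (hk : 1 ≤ k ∧ k ≤ n) (m v : MM N) :
    comm (rhoHn n N pos kappa lam k m) (rhoF0 n N pos kappa lam v) =
      (rootCoeff k 1 - rootCoeff k (n + 1)) • rhoF0 n N pos kappa lam (v + m) := by
  have hH := isLinearMap_rhoHn (n := n) (pos := pos) kappa lam k m
  rw [rhoF0_eq, rhoF0_eq, comm_sub_right hH, comm_neg_right hH, smul_sub, smul_neg]
  simp only [comm_sum_right hH, Finset.smul_sum]
  refine congrArg₂ (fun a b => -a - b) ?_ ?_
  · refine Finset.sum_congr rfl fun r _ => Finset.sum_congr rfl fun j _ =>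
      Finset.sum_congr rfl fun s _ => ?_
    split_ifs
    · exact comm_rhoHn_pathTerm _ _ _ _ _ _ _
    · rw [comm_zero_right hH, smul_zero]
  · refine Finset.sum_congr rfl fun s hs => ?_
    rw [comm_rhoHn_chain (XConstant.endFactor _ _ _) (comm_rhoHn_endFactor htri hzero hdisj kappa lam
      hE1 hE2 hk (qend_mem_Icc hs) m), sum_map_qpairs_ql, sub_add_sub_cancel]

end LoweringZero

section Cartan

variable {n : ℕ}

theorem rootCoeff_one_sub (k : ℕ) (hk : 1 ≤ k ∧ k ≤ n) :
    rootCoeff k 1 - rootCoeff k (n + 1) = (if k = 1 then 1 else 0) + (if k = n then 1 else 0) := by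
  simp only [rootCoeff]
  split_ifs <;> first | omega | norm_num

theorem neg_Acar_zero (hn : 2 ≤ n) (k : ℕ) (hk : k ≤ n) :
    -Acar n k 0 = if k = 0 then -2 else (if k = 1 then 1 else 0) + (if k = n then 1 else 0) := by
  have h1 : (k + 1) % (n + 1) = 0 % (n + 1) ↔ k = n := by
    rcases hk.eq_or_lt with rfl | h
    · simp
    · rw [Nat.zero_mod, Nat.mod_eq_of_lt (by omega)]
      omega
  have h2 : (0 + 1) % (n + 1) = k % (n + 1) ↔ k = 1 := by
    rw [Nat.mod_eq_of_lt (by omega), Nat.mod_eq_of_lt (by omega)]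
    omega
  simp only [Acar, AcarZ, h1, h2]
  split_ifs <;> first | omega | norm_num

end Cartan

/-- For all `0 ≤ k ≤ n` and `m, n ∈ ℤ^{N+1}`,
`[ρ(H_k)_m, ρ(F_0)_n] = -Â_{k0} ρ(F_0)_{m+n}` as operators on `V`; explicitly,
the bracket is `ρ(F_0)_{m+n}` when `k = 1` or `k = n`, is `-2 ρ(F_0)_{m+n}`
when `k = 0`, and vanishes otherwise. -/
theorem stmt13 (n N : ℕ) (hn : 2 ≤ n) (hN : 1 ≤ N)
    (pos : MM N → Prop)
    (hadd : ∀ a b : MM N, pos a → pos b → pos (a + b))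
    (htri : ∀ a : MM N, pos a ∨ a = 0 ∨ pos (-a))
    (hzero : ¬ pos (0 : MM N))
    (hdisj : ∀ a : MM N, pos a → ¬ pos (-a))
    (kappa : MM N → Fin (N + 1) → ℂ) (lam : ℕ → ℂ)
    (hE1 : ∀ m : MM N, ∑ p : Fin (N + 1), (m p : ℂ) * kappa m p = 0)
    (hE2 : ∀ m k : MM N, pos m → pos k →
      ∑ p : Fin (N + 1), (m p : ℂ) * kappa (-m - k) p = 0) :
    ∀ k : ℕ, k ≤ n → ∀ m mm : MM N,
      (comm (rhoH n N pos kappa lam k m) (rhoF0 n N pos kappa lam mm)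
          = (-(Acar n k 0)) • rhoF0 n N pos kappa lam (m + mm))
      ∧ (k = 1 ∨ k = n →
          comm (rhoH n N pos kappa lam k m) (rhoF0 n N pos kappa lam mm)
            = rhoF0 n N pos kappa lam (m + mm))
      ∧ (k = 0 →
          comm (rhoH n N pos kappa lam k m) (rhoF0 n N pos kappa lam mm)
            = (-2 : ℂ) • rhoF0 n N pos kappa lam (m + mm))
      ∧ (k ≠ 0 → k ≠ 1 → k ≠ n →
          comm (rhoH n N pos kappa lam k m) (rhoF0 n N pos kappa lam mm) = 0) := by
  have main : ∀ k ≤ n, ∀ m mm : MM N,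
      comm (rhoH n N pos kappa lam k m) (rhoF0 n N pos kappa lam mm) =
        (if k = 0 then -2 else (if k = 1 then 1 else 0) + (if k = n then 1 else 0) : ℂ) •
          rhoF0 n N pos kappa lam (m + mm) := by
    intro k hk m mm
    have hpos : ∀ s, 1 ≤ s ∧ s ≤ n →
        comm (rhoHn n N pos kappa lam s m) (rhoF0 n N pos kappa lam mm) =
          ((if s = 1 then 1 else 0) + (if s = n then 1 else 0) : ℂ) •
            rhoF0 n N pos kappa lam (m + mm) := fun s hs => by
      rw [comm_rhoHn_rhoF0 htri hzero hdisj kappa lam hE1 hE2 hs, rootCoeff_one_sub s hs,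
        add_comm mm]
    by_cases h0 : k = 0
    · have hF := isLinearMap_rhoF0 (n := n) (pos := pos) kappa lam mm
      rw [rhoH, if_pos h0, if_pos h0, comm_neg_left hF, comm_sum_left hF,
        Finset.sum_congr rfl fun s hs => hpos s (Finset.mem_Icc.1 hs), ← Finset.sum_smul,
        Finset.sum_add_distrib, Finset.sum_ite_eq', Finset.sum_ite_eq',
        if_pos (Finset.mem_Icc.2 (by omega)), if_pos (Finset.mem_Icc.2 (by omega)), ← neg_smul]
      norm_num
    · rw [rhoH, if_neg h0, if_neg h0, hpos k (by omega)]
  intro k hk m mm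
  rw [neg_Acar_zero hn k hk, main k hk]
  refine ⟨rfl, ?_, ?_, ?_⟩
  · intro h
    have : (if k = 0 then -2 else (if k = 1 then 1 else 0) + (if k = n then 1 else 0) : ℂ) = 1 := by
      split_ifs <;> first | omega | norm_num
    rw [this, one_smul]
  · intro h
    rw [if_pos h]
  · intro h0 h1 h2
    simp [h0, h1, h2]

end Stmt13
end
end
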